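/- arXiv:1011.3009 — 4 statements merged into one kernel-verified Lean document; each statement's English description precedes it below -/
import Mathlib

section
/- F is the only proper nonzero two-sided ideal of I_1: one has 0 ≠ F ≠ I_1, and every two-sided ideal of I_1 is equal to 0, F, or I_1. In particular the quotient ring B_1 := I_1/F is a simple ring. -/
set_option linter.unusedSectionVars false

open Polynomial

noncomputable section

variable (K : Type*) [Field K] [CharZero K]

/-- Formal differentiation `∂` as a `K`-linear endomorphism of `K[x]`. -/
def derOp : Module.End K (Polynomial K) := Polynomial.derivative

/-- Multiplication by `x` as a `K`-linear endomorphism of `K[x]`. -/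
def xOp : Module.End K (Polynomial K) := LinearMap.mulLeft K (Polynomial.X : Polynomial K)

/-- Integration `∫`: the unique `K`-linear map with `∫ xⁿ = xⁿ⁺¹/(n+1)`. -/
def intOp : Module.End K (Polynomial K) :=
  Polynomial.lsum fun n => ((n : K) + 1)⁻¹ • Polynomial.monomial (n + 1)

/-- The algebra `I₁` of polynomial integro-differential operators: the unital
`K`-subalgebra of `End_K K[x]` generated by `X`, `∂` and `∫`. -/
def I1 : Subalgebra K (Module.End K (Polynomial K)) :=
  Algebra.adjoin K {xOp K, derOp K, intOp K}

/-- `H := ∂ ∘ X`. -/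
def Hop : Module.End K (Polynomial K) := derOp K * xOp K

/-- `e_{ij} := ∫^i ∂^j - ∫^{i+1} ∂^{j+1}`. -/
def eOp (i j : ℕ) : Module.End K (Polynomial K) :=
  intOp K ^ i * derOp K ^ j - intOp K ^ (i + 1) * derOp K ^ (j + 1)

/-- `F`, the `K`-linear span of the `e_{ij}`. -/
def Fspan : Submodule K (Module.End K (Polynomial K)) :=
  Submodule.span K (Set.range fun p : ℕ × ℕ => eOp K p.1 p.2)

lemma xOp_mem : xOp K ∈ I1 K := Algebra.subset_adjoin (by simp)
lemma derOp_mem : derOp K ∈ I1 K := Algebra.subset_adjoin (by simp)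
lemma intOp_mem : intOp K ∈ I1 K := Algebra.subset_adjoin (by simp)
lemma Hop_mem : Hop K ∈ I1 K := mul_mem (derOp_mem K) (xOp_mem K)
lemma eOp_mem (i j : ℕ) : eOp K i j ∈ I1 K :=
  sub_mem (mul_mem (pow_mem (intOp_mem K) i) (pow_mem (derOp_mem K) j))
    (mul_mem (pow_mem (intOp_mem K) (i + 1)) (pow_mem (derOp_mem K) (j + 1)))

/-- `H` as an element of `I₁`. -/
def HelI : I1 K := ⟨Hop K, Hop_mem K⟩
/-- `∂` as an element of `I₁`. -/
def DelI : I1 K := ⟨derOp K, derOp_mem K⟩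
/-- `∫` as an element of `I₁`. -/
def IntI : I1 K := ⟨intOp K, intOp_mem K⟩

set_option synthInstance.maxHeartbeats 400000
set_option maxHeartbeats 1000000

/-- divided powers, indexed by integers -/
def pz (z : ℤ) : Polynomial K :=
  if 0 ≤ z then Polynomial.monomial z.toNat ((z.toNat.factorial : K)⁻¹) else 0

lemma pz_nat (n : ℕ) : pz K (n : ℤ) = Polynomial.monomial n ((n.factorial : K)⁻¹) := by
  simp [pz]

lemma pz_neg (z : ℤ) (h : z < 0) : pz K z = 0 := by
  simp [pz, h]

lemma fac_ne (n : ℕ) : (n.factorial : K) ≠ 0 := by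
  exact_mod_cast n.factorial_ne_zero

lemma monomial_eq (n : ℕ) (c : K) :
    Polynomial.monomial n c = (c * n.factorial) • pz K (n : ℤ) := by
  rw [pz_nat, Polynomial.smul_monomial, smul_eq_mul, mul_assoc, mul_inv_cancel₀ (fac_ne K n),
    mul_one]

lemma der_pz (z : ℤ) : derOp K (pz K z) = pz K (z - 1) := by
  rcases lt_or_ge z 0 with h | h
  · rw [pz_neg K z h, pz_neg K _ (by omega), map_zero]
  · lift z to ℕ using h
    rcases z with _ | n
    · rw [pz_nat, pz_neg K _ (by simp)]
      simp [derOp]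
    · have : ((n + 1 : ℕ) : ℤ) - 1 = (n : ℤ) := by push_cast; ring
      rw [this, pz_nat, pz_nat, derOp, Polynomial.derivative_monomial]
      congr 1
      have := fac_ne K n
      have h2 : ((n : K) + 1) ≠ 0 := by exact_mod_cast Nat.succ_ne_zero n
      rw [Nat.factorial_succ]
      push_cast
      field_simp

lemma x_pz (z : ℤ) : xOp K (pz K z) = ((z : K) + 1) • pz K (z + 1) := by
  rcases lt_or_ge z 0 with h | h
  · rw [pz_neg K z h, map_zero]
    rcases lt_or_ge (z + 1) 0 with h' | h'
    · rw [pz_neg K _ h', smul_zero]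
    · have : z = -1 := by omega
      subst this
      simp
  · lift z to ℕ using h
    have : ((z : ℕ) : ℤ) + 1 = ((z + 1 : ℕ) : ℤ) := by push_cast; ring
    rw [this, pz_nat, pz_nat, xOp, LinearMap.mulLeft_apply, Polynomial.X_mul_monomial,
      Polynomial.smul_monomial]
    congr 1
    have := fac_ne K z
    have h2 : ((z : K) + 1) ≠ 0 := by exact_mod_cast Nat.succ_ne_zero z
    rw [Nat.factorial_succ]
    push_cast
    rw [smul_eq_mul]
    field_simp

lemma int_pz (z : ℤ) (h : 0 ≤ z) : intOp K (pz K z) = pz K (z + 1) := by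
  lift z to ℕ using h
  have : ((z : ℕ) : ℤ) + 1 = ((z + 1 : ℕ) : ℤ) := by push_cast; ring
  rw [this, pz_nat, pz_nat, intOp, Polynomial.lsum_apply, Polynomial.sum_monomial_index _ _ (by simp)]
  rw [LinearMap.smul_apply, Polynomial.smul_monomial]
  congr 1
  rw [Nat.factorial_succ]
  push_cast
  rw [smul_eq_mul, mul_inv]

lemma H_pz (z : ℤ) : Hop K (pz K z) = ((z : K) + 1) • pz K z := by
  rw [Hop, Module.End.mul_apply, x_pz, map_smul, der_pz, add_sub_cancel_right]

lemma der_pow_pz (j : ℕ) (z : ℤ) : (derOp K ^ j) (pz K z) = pz K (z - j) := by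
  induction j generalizing z with
  | zero => simp
  | succ j ih => rw [pow_succ, Module.End.mul_apply, der_pz, ih]; congr 1; push_cast; ring

lemma int_pow_pz (j : ℕ) (z : ℤ) (h : 0 ≤ z) : (intOp K ^ j) (pz K z) = pz K (z + j) := by
  induction j generalizing z with
  | zero => simp
  | succ j ih =>
    rw [pow_succ, Module.End.mul_apply, int_pz K z h, ih _ (by omega)]; congr 1; push_cast; ring

lemma end_ext (a b : Module.End K (Polynomial K)) (h : ∀ n : ℕ, a (pz K n) = b (pz K n)) :
    a = b := by
  apply LinearMap.ext
  intro q
  induction q using Polynomial.induction_on' with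
  | add p q hp hq => rw [map_add, map_add, hp, hq]
  | monomial n c => rw [monomial_eq, map_smul, map_smul, h]

/-- coordinate functional -/
def lam (j : ℕ) : Polynomial K →ₗ[K] K := (j.factorial : K) • Polynomial.lcoeff K j

lemma lam_pz (j n : ℕ) : lam K j (pz K n) = if n = j then 1 else 0 := by
  rw [pz_nat, lam, LinearMap.smul_apply, Polynomial.lcoeff_apply, Polynomial.coeff_monomial]
  split_ifs with h
  · subst h; exact mul_inv_cancel₀ (fac_ne K n)
  · simp

lemma eOp_pz (i j n : ℕ) : eOp K i j (pz K n) = if n = j then pz K i else 0 := by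
  rw [eOp, LinearMap.sub_apply, Module.End.mul_apply, Module.End.mul_apply, der_pow_pz, der_pow_pz]
  rcases lt_trichotomy n j with h | h | h
  · rw [pz_neg K _ (by omega), pz_neg K _ (by push_cast; omega), if_neg (by omega)]
    simp
  · rw [int_pow_pz K _ _ (by omega), pz_neg K (_ - ((j + 1 : ℕ) : ℤ)) (by push_cast; omega), if_pos h]
    subst h
    simp
  · rw [int_pow_pz K _ _ (by omega), int_pow_pz K _ _ (by push_cast; omega), if_neg (by omega),
      sub_eq_zero]
    congr 1
    push_cast
    ring

lemma eOp_eq (i j : ℕ) : eOp K i j = (lam K j).smulRight (pz K i) := by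
  apply end_ext
  intro n
  rw [eOp_pz, LinearMap.smulRight_apply, lam_pz]
  split_ifs <;> simp

lemma smulRight_mem (j : ℕ) (q : Polynomial K) :
    ((lam K j).smulRight q : Module.End K (Polynomial K)) ∈ Fspan K := by
  induction q using Polynomial.induction_on' with
  | add p q hp hq =>
    have : ((lam K j).smulRight (p + q) : Module.End K (Polynomial K))
      = (lam K j).smulRight p + (lam K j).smulRight q := by
      apply LinearMap.ext; intro x
      rw [LinearMap.add_apply]
      simp only [LinearMap.smulRight_apply, smul_add]
    rw [this]; exact add_mem hp hq
  | monomial n c =>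
    have : ((lam K j).smulRight (Polynomial.monomial n c) : Module.End K (Polynomial K))
      = (c * n.factorial) • eOp K n j := by
      rw [eOp_eq, monomial_eq]
      apply LinearMap.ext; intro x
      simp only [LinearMap.smulRight_apply, LinearMap.smul_apply]
      rw [smul_comm]
    rw [this]
    exact Submodule.smul_mem _ _ (Submodule.subset_span ⟨(n, j), rfl⟩)

lemma mem_F_of_kill (N : ℕ) (a : Module.End K (Polynomial K))
    (h : ∀ n : ℕ, N ≤ n → a (pz K n) = 0) : a ∈ Fspan K := by
  induction N generalizing a with
  | zero =>
    have : a = 0 := end_ext K _ _ (fun n => by simpa using h n (Nat.zero_le _))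
    rw [this]; exact zero_mem _
  | succ N ih =>
    have := ih (a - (lam K N).smulRight (a (pz K N))) (by
      intro n hn
      rw [LinearMap.sub_apply, LinearMap.smulRight_apply, lam_pz]
      split_ifs with h1
      · subst h1; simp
      · rw [h n (by omega)]; simp)
    have h2 := add_mem this (smulRight_mem K N (a (pz K N)))
    simpa using h2

lemma kill_of_mem_F (a : Module.End K (Polynomial K)) (h : a ∈ Fspan K) :
    ∃ N : ℕ, ∀ n : ℕ, N ≤ n → a (pz K n) = 0 := by
  induction h using Submodule.span_induction with
  | mem x hx =>
    obtain ⟨⟨i, j⟩, rfl⟩ := hx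
    refine ⟨j + 1, fun n hn => ?_⟩
    simp only
    rw [eOp_pz, if_neg (by omega)]
  | zero => exact ⟨0, fun n _ => rfl⟩
  | add x y _ _ hx hy =>
    obtain ⟨N, hN⟩ := hx
    obtain ⟨M, hM⟩ := hy
    refine ⟨max N M, fun n hn => ?_⟩
    rw [LinearMap.add_apply, hN n (by omega), hM n (by omega), add_zero]
  | smul c x _ hx =>
    obtain ⟨N, hN⟩ := hx
    exact ⟨N, fun n hn => by rw [LinearMap.smul_apply, hN n hn, smul_zero]⟩

lemma pz_ne (n : ℕ) : pz K n ≠ 0 := by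
  intro h
  have := lam_pz K n n
  rw [h] at this
  simp at this

/-- eventual normal form -/
def NF (s : ℤ → Polynomial K) (φ : ℤ →₀ Polynomial K) : Prop :=
  ∀ᶠ n : ℤ in Filter.atTop, s n = φ.sum fun k f => f.eval (n : K) • pz K (n + k)

lemma NF_add (s t : ℤ → Polynomial K) (φ ψ : ℤ →₀ Polynomial K) (hs : NF K s φ) (ht : NF K t ψ) :
    NF K (s + t) (φ + ψ) := by
  filter_upwards [hs, ht] with n h1 h2
  rw [Pi.add_apply, h1, h2, Finsupp.sum_add_index']
  · intro k; simp
  · intro k f g; rw [Polynomial.eval_add, add_smul]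

/-- sequences with an eventual normal form -/
def V : Submodule K (ℤ → Polynomial K) where
  carrier := {s | ∃ φ, NF K s φ}
  add_mem' := by
    rintro s t ⟨φ, h1⟩ ⟨ψ, h2⟩
    exact ⟨_, NF_add K s t φ ψ h1 h2⟩
  zero_mem' := ⟨0, Filter.Eventually.of_forall fun n => by simp⟩
  smul_mem' := by
    rintro c s ⟨φ, h1⟩
    refine ⟨φ.mapRange (fun f => Polynomial.C c * f) (by simp), ?_⟩
    filter_upwards [h1] with n h1
    rw [Pi.smul_apply, h1, Finsupp.sum_mapRange_index (by simp), Finsupp.smul_sum]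
    simp [mul_smul]

lemma V_single (s : ℤ → Polynomial K) (k : ℤ) (f : Polynomial K)
    (h : ∀ᶠ n : ℤ in Filter.atTop, s n = f.eval (n : K) • pz K (n + k)) : s ∈ V K := by
  refine ⟨Finsupp.single k f, ?_⟩
  filter_upwards [h] with n h
  rw [h, Finsupp.sum_single_index (by simp)]

lemma V_congr (s t : ℤ → Polynomial K) (h : ∀ᶠ n : ℤ in Filter.atTop, s n = t n) (ht : t ∈ V K) :
    s ∈ V K := by
  obtain ⟨φ, hφ⟩ := ht
  refine ⟨φ, ?_⟩
  filter_upwards [h, hφ] with n h1 h2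
  rw [h1, h2]

/-- operators preserving `V` -/
def VP (T : Module.End K (Polynomial K)) : Prop := ∀ s ∈ V K, (fun n => T (s n)) ∈ V K

lemma VP_of (T : Module.End K (Polynomial K))
    (h : ∀ (k : ℤ) (f : Polynomial K), (fun n : ℤ => T (f.eval (n : K) • pz K (n + k))) ∈ V K) :
    VP K T := by
  rintro s ⟨φ, hφ⟩
  apply V_congr K _ (fun n : ℤ => T (φ.sum fun k f => f.eval (n : K) • pz K (n + k)))
  · filter_upwards [hφ] with n hn
    rw [hn]
  · have : (fun n : ℤ => T (φ.sum fun k f => f.eval (n : K) • pz K (n + k)))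
        = ∑ k ∈ φ.support, (fun n : ℤ => T ((φ k).eval (n : K) • pz K (n + k))) := by
      funext n
      rw [Finsupp.sum, map_sum, Finset.sum_apply]
    rw [this]
    exact sum_mem fun k _ => h k _

lemma VP_I1 (a : Module.End K (Polynomial K)) (ha : a ∈ I1 K) : VP K a := by
  induction ha using Algebra.adjoin_induction with
  | mem x hx =>
    rcases hx with rfl | rfl | rfl
    · apply VP_of
      intro k f
      apply V_single K _ (k + 1) (f * (Polynomial.X + Polynomial.C ((k : K) + 1)))
      refine Filter.Eventually.of_forall fun n => ?_
      rw [map_smul, x_pz, smul_smul, add_assoc]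
      simp [add_assoc]
    · apply VP_of
      intro k f
      apply V_single K _ (k - 1) f
      refine Filter.Eventually.of_forall fun n => ?_
      rw [map_smul, der_pz, add_sub_assoc]
    · apply VP_of
      intro k f
      apply V_single K _ (k + 1) f
      filter_upwards [Filter.eventually_ge_atTop (-k)] with n hn
      rw [map_smul, int_pz K _ (by omega), add_assoc]
  | algebraMap r =>
    intro s hs
    exact (V K).smul_mem r hs
  | add x y _ _ hx hy =>
    intro s hs
    exact (V K).add_mem (hx s hs) (hy s hs)
  | mul x y _ _ hx hy =>
    intro s hs
    exact hx _ (hy s hs)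

lemma exists_NF (a : Module.End K (Polynomial K)) (ha : a ∈ I1 K) :
    ∃ φ, NF K (fun n => a (pz K n)) φ := by
  apply VP_I1 K a ha
  apply V_single K _ 0 1
  exact Filter.Eventually.of_forall fun n => by simp

variable {K}

/-- membership of an operator in an ideal of `I1` -/
def InJ (J : TwoSidedIdeal (I1 K)) (a : Module.End K (Polynomial K)) : Prop :=
  ∃ h : a ∈ I1 K, (⟨a, h⟩ : I1 K) ∈ J

lemma InJ.left {J : TwoSidedIdeal (I1 K)} {a b : Module.End K (Polynomial K)}
    (ha : a ∈ I1 K) (hb : InJ J b) : InJ J (a * b) := by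
  obtain ⟨h, hb⟩ := hb
  exact ⟨mul_mem ha h, J.mul_mem_left ⟨a, ha⟩ _ hb⟩

lemma InJ.right {J : TwoSidedIdeal (I1 K)} {a b : Module.End K (Polynomial K)}
    (ha : InJ J a) (hb : b ∈ I1 K) : InJ J (a * b) := by
  obtain ⟨h, ha⟩ := ha
  exact ⟨mul_mem h hb, J.mul_mem_right _ ⟨b, hb⟩ ha⟩

lemma InJ.add {J : TwoSidedIdeal (I1 K)} {a b : Module.End K (Polynomial K)}
    (ha : InJ J a) (hb : InJ J b) : InJ J (a + b) := by
  obtain ⟨h, ha⟩ := ha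
  obtain ⟨h', hb⟩ := hb
  exact ⟨add_mem h h', J.add_mem ha hb⟩

lemma InJ.smul {J : TwoSidedIdeal (I1 K)} {a : Module.End K (Polynomial K)} (c : K)
    (ha : InJ J a) : InJ J (c • a) := by
  rw [Algebra.smul_def]
  exact InJ.left ((I1 K).algebraMap_mem c) ha

lemma InJ.sub {J : TwoSidedIdeal (I1 K)} {a b : Module.End K (Polynomial K)}
    (ha : InJ J a) (hb : InJ J b) : InJ J (a - b) := by
  have h := ha.add (hb.smul (-1))
  have e : a - b = a + (-1 : K) • b := by
    apply LinearMap.ext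
    intro x
    rw [LinearMap.sub_apply, LinearMap.add_apply, LinearMap.smul_apply, neg_one_smul,
      sub_eq_add_neg]
  rwa [e]

lemma InJ.zero (J : TwoSidedIdeal (I1 K)) : InJ J 0 := ⟨zero_mem _, J.zero_mem⟩

lemma F_le {J : TwoSidedIdeal (I1 K)} {a : Module.End K (Polynomial K)} (ha : InJ J a)
    (h0 : a ≠ 0) (b : Module.End K (Polynomial K)) (hb : b ∈ Fspan K) : InJ J b := by
  obtain ⟨j, hj⟩ : ∃ j : ℕ, a (pz K j) ≠ 0 := by
    by_contra! h
    exact h0 (end_ext K _ _ (fun n => by simpa using h n))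
  obtain ⟨i, hi⟩ : ∃ i : ℕ, lam K i (a (pz K j)) ≠ 0 := by
    refine ⟨(a (pz K j)).natDegree, ?_⟩
    simp only [lam, LinearMap.smul_apply, Polynomial.lcoeff_apply]
    exact mul_ne_zero (fac_ne K _) (by simpa using hj)
  have key : ∀ k l : ℕ, InJ J (eOp K k l) := by
    intro k l
    have h1 := ((InJ.left (eOp_mem K k i) ha).right (eOp_mem K j l)).smul (lam K i (a (pz K j)))⁻¹
    convert h1 using 1
    apply end_ext
    intro n
    rw [LinearMap.smul_apply, Module.End.mul_apply, Module.End.mul_apply, eOp_pz, eOp_pz]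
    split_ifs
    · rw [eOp_eq, LinearMap.smulRight_apply, smul_smul, inv_mul_cancel₀ hi, one_smul]
    · simp
  induction hb using Submodule.span_induction with
  | mem x hx =>
    obtain ⟨⟨i, j⟩, rfl⟩ := hx
    exact key i j
  | zero => exact InJ.zero J
  | add x y _ _ hx hy => exact hx.add hy
  | smul c x _ hx => exact hx.smul c

lemma mem_F_of_ev (a : Module.End K (Polynomial K))
    (h : ∀ᶠ n : ℤ in Filter.atTop, a (pz K n) = 0) : a ∈ Fspan K := by
  obtain ⟨N, hN⟩ := Filter.eventually_atTop.1 h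
  exact mem_F_of_kill K N.toNat a (fun n hn => hN n (by omega))

lemma ev_shift {P : ℤ → Prop} (h : ∀ᶠ n : ℤ in Filter.atTop, P n) (k : ℤ) :
    ∀ᶠ n : ℤ in Filter.atTop, P (n + k) :=
  (Filter.tendsto_atTop_add_const_right _ k Filter.tendsto_id).eventually h

lemma one_of_const {J : TwoSidedIdeal (I1 K)} {a : Module.End K (Polynomial K)} (ha : InJ J a)
    (c : K) (hc : c ≠ 0) (h : ∀ᶠ n : ℤ in Filter.atTop, a (pz K n) = c • pz K n) : InJ J 1 := by
  have h0 : a ≠ 0 := by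
    rintro rfl
    obtain ⟨n, h1, h2⟩ := (h.and (Filter.eventually_ge_atTop 0)).exists
    lift n to ℕ using h2
    rw [LinearMap.zero_apply, eq_comm, smul_eq_zero] at h1
    exact h1.elim hc (pz_ne K n)
  have h1 : (1 - c⁻¹ • a : Module.End K (Polynomial K)) ∈ Fspan K := by
    apply mem_F_of_ev
    filter_upwards [h] with n hn
    rw [LinearMap.sub_apply, LinearMap.smul_apply, hn, smul_smul, inv_mul_cancel₀ hc]
    simp
  have := (F_le ha h0 _ h1).add (ha.smul c⁻¹)
  simpa using this

lemma one_of_single (d : ℕ) {J : TwoSidedIdeal (I1 K)} {a : Module.End K (Polynomial K)}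
    (ha : InJ J a) (k : ℤ) (f : Polynomial K) (hf : f ≠ 0) (hd : f.natDegree ≤ d)
    (h : ∀ᶠ n : ℤ in Filter.atTop, a (pz K n) = f.eval (n : K) • pz K (n + k)) : InJ J 1 := by
  induction d generalizing a f with
  | zero =>
    obtain ⟨c, rfl⟩ : ∃ c, f = Polynomial.C c :=
      ⟨_, Polynomial.eq_C_of_natDegree_eq_zero (by omega)⟩
    have hc : c ≠ 0 := by rintro rfl; simp at hf
    rcases le_total 0 k with hk | hk
    · lift k to ℕ using hk
      refine one_of_const (InJ.left (pow_mem (derOp_mem K) k) ha) c hc ?_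
      filter_upwards [h] with n hn
      rw [Module.End.mul_apply, hn, map_smul, der_pow_pz]
      simp
    · obtain ⟨m, rfl⟩ : ∃ m : ℕ, k = -m := ⟨k.natAbs, by omega⟩
      refine one_of_const (InJ.left (pow_mem (intOp_mem K) m) ha) c hc ?_
      filter_upwards [h, Filter.eventually_ge_atTop (m : ℤ)] with n hn hm
      rw [Module.End.mul_apply, hn, map_smul, int_pow_pz K _ _ (by omega)]
      simp
  | succ d ih =>
    rcases Nat.lt_or_ge f.natDegree (d + 1) with h1 | h1
    · exact ih ha f hf (by omega) h
    · have hdeg : f.natDegree = d + 1 := le_antisymm hd h1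
      have hne : f.comp (Polynomial.X + Polynomial.C 1) - f ≠ 0 := by
        intro hz
        have hstep : ∀ x : K, f.eval (x + 1) = f.eval x := by
          intro x
          have := congrArg (Polynomial.eval x) (sub_eq_zero.1 hz)
          simpa using this
        have hn : ∀ n : ℕ, f.eval (n : K) = f.eval 0 := by
          intro n
          induction n with
          | zero => simp
          | succ n ihn => rw [Nat.cast_succ, hstep, ihn]
        have hC : f = Polynomial.C (f.eval 0) := by
          apply Polynomial.eq_of_infinite_eval_eq
          refine (Set.infinite_range_of_injective (Nat.cast_injective (R := K))).mono ?_
          rintro _ ⟨n, rfl⟩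
          simpa using hn n
        rw [hC, Polynomial.natDegree_C] at hdeg
        omega
      have hcomp : (f.comp (Polynomial.X + Polynomial.C 1) - f).natDegree ≤ d := by
        have h2 := Polynomial.degree_sub_lt_left (Polynomial.degree_taylor f 1)
          (by rwa [Ne, Polynomial.taylor_eq_zero]) (Polynomial.leadingCoeff_taylor 1 f)
        rw [Polynomial.degree_taylor, Polynomial.taylor_apply] at h2
        have h3 := Polynomial.natDegree_lt_natDegree hne h2
        omega
      refine ih (((InJ.left (derOp_mem K) ha).right (intOp_mem K)).sub ha) _ hne hcomp ?_
      filter_upwards [h, ev_shift h 1, Filter.eventually_ge_atTop 0] with n h1 h2 h3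
      rw [LinearMap.sub_apply, Module.End.mul_apply, Module.End.mul_apply, int_pz K _ h3, h1, h2,
        map_smul, der_pz, Polynomial.eval_sub, sub_smul]
      have : n + 1 + k - 1 = n + k := by ring
      rw [this]
      simp

lemma one_of_NF (N : ℕ) {J : TwoSidedIdeal (I1 K)} {a : Module.End K (Polynomial K)}
    (ha : InJ J a) (φ : ℤ →₀ Polynomial K) (h0 : φ ≠ 0) (hN : φ.support.card ≤ N)
    (h : NF K (fun n => a (pz K n)) φ) : InJ J 1 := by
  induction N generalizing a φ with
  | zero => simp at hN; exact absurd hN h0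
  | succ N ih =>
    obtain ⟨k, hk⟩ := Finsupp.ne_iff.1 h0
    rw [Finsupp.zero_apply] at hk
    by_cases hs : ∃ l ≠ k, φ l ≠ 0
    · obtain ⟨l, hl, hφl⟩ := hs
      let ψ : ℤ →₀ Polynomial K := Finsupp.onFinset (φ.support.erase k)
        (fun j => ((j - k : ℤ) : K) • φ j) (by
          intro j hj
          simp only [Finset.mem_erase, Finsupp.mem_support_iff]
          constructor
          · rintro rfl; simp at hj
          · intro hz; simp [hz] at hj)
      have hψ0 : ψ ≠ 0 := by
        intro hz
        have := DFunLike.congr_fun hz l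
        simp only [ψ, Finsupp.onFinset_apply, Finsupp.zero_apply, smul_eq_zero, Int.cast_eq_zero] at this
        rcases this with h | h
        · omega
        · exact hφl h
      have hcard : ψ.support.card ≤ N := by
        refine (Finset.card_le_card Finsupp.support_onFinset_subset).trans ?_
        rw [Finset.card_erase_of_mem (by simpa using hk)]
        omega
      refine ih (((InJ.left (Hop_mem K) ha).sub (ha.right (Hop_mem K))).sub (ha.smul (k : K)))
        ψ hψ0 hcard ?_
      filter_upwards [h] with n hn
      have e1 : (ψ.sum fun k f => f.eval (n : K) • pz K (n + k))
          = φ.sum fun j f => (((j - k : ℤ) : K) * f.eval (n : K)) • pz K (n + j) := by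
        rw [Finsupp.sum_of_support_subset ψ
          (Finsupp.support_onFinset_subset.trans (Finset.erase_subset _ _)) _ (by simp), Finsupp.sum]
        refine Finset.sum_congr rfl fun j _ => ?_
        simp [ψ]
      rw [e1, LinearMap.sub_apply, LinearMap.sub_apply, Module.End.mul_apply, Module.End.mul_apply,
        LinearMap.smul_apply, H_pz, map_smul, hn, Finsupp.sum, Finsupp.sum, map_sum,
        Finset.smul_sum, Finset.smul_sum, ← Finset.sum_sub_distrib, ← Finset.sum_sub_distrib]
      refine Finset.sum_congr rfl fun j _ => ?_
      rw [map_smul, H_pz, smul_smul, smul_smul, smul_smul, ← sub_smul, ← sub_smul]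
      congr 1
      push_cast
      ring
    · push Not at hs
      refine one_of_single _ ha k (φ k) hk le_rfl ?_
      filter_upwards [h] with n hn
      rw [hn, Finsupp.sum_of_support_subset φ (s := {k}) ?_ _ (by simp), Finset.sum_singleton]
      intro j hj
      by_contra hjk
      exact (Finsupp.mem_support_iff.1 hj) (hs j (by simpa using hjk))

lemma one_of_not_mem {J : TwoSidedIdeal (I1 K)} {a : Module.End K (Polynomial K)}
    (ha : InJ J a) (hF : a ∉ Fspan K) : InJ J 1 := by
  obtain ⟨φ, hφ⟩ := exists_NF K a ha.1
  refine one_of_NF _ ha φ ?_ le_rfl hφ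
  rintro rfl
  apply hF
  apply mem_F_of_ev
  filter_upwards [hφ] with n hn
  simpa using hn

variable (K)

/-- `F` is the only proper nonzero two-sided ideal of `I₁`:
`0 ≠ F ≠ I₁` and every two-sided ideal of `I₁` is `0`, `F` or `I₁`. In particular the
quotient ring `B₁ := I₁/F` is a simple ring. -/
theorem F_is_the_only_proper_nonzero_twoSidedIdeal
    (FI : TwoSidedIdeal (I1 K))
    (hFI : ∀ a : I1 K, a ∈ FI ↔ (a : Module.End K (Polynomial K)) ∈ Fspan K) :
    FI ≠ ⊥ ∧ FI ≠ ⊤ ∧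
    (∀ J : TwoSidedIdeal (I1 K), J = ⊥ ∨ J = FI ∨ J = ⊤) ∧
    IsSimpleRing FI.ringCon.Quotient := by
  have h1F : (1 : Module.End K (Polynomial K)) ∉ Fspan K := by
    intro h
    obtain ⟨N, hN⟩ := kill_of_mem_F K _ h
    exact pz_ne K N (hN N le_rfl)
  have h1 : (1 : I1 K) ∉ FI := fun h => h1F ((hFI 1).1 h)
  have htop : FI ≠ ⊤ := by
    rintro rfl
    exact h1 (TwoSidedIdeal.mem_top _)
  have hall : ∀ J : TwoSidedIdeal (I1 K), J = ⊥ ∨ J = FI ∨ J = ⊤ := by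
    intro J
    by_cases hJ : ∃ a ∈ J, (a : Module.End K (Polynomial K)) ∉ Fspan K
    · obtain ⟨a, ha, haF⟩ := hJ
      obtain ⟨_, h⟩ := one_of_not_mem (J := J) ⟨a.2, ha⟩ haF
      right; right
      rw [eq_top_iff]
      intro x _
      have := J.mul_mem_left x _ h
      have e : x * (⟨1, by assumption⟩ : I1 K) = x := mul_one x
      rwa [e] at this
    · push Not at hJ
      by_cases hz : ∃ a ∈ J, a ≠ 0
      · obtain ⟨a, ha, ha0⟩ := hz
        right; left
        apply le_antisymm
        · intro x hx
          exact (hFI x).2 (hJ x hx)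
        · intro x hx
          obtain ⟨_, h⟩ := F_le (J := J) ⟨a.2, ha⟩ (fun h => ha0 (Subtype.ext h)) _ ((hFI x).1 hx)
          exact h
      · push Not at hz
        left
        rw [eq_bot_iff]
        intro x hx
        rw [hz x hx]
        exact zero_mem _
  refine ⟨?_, htop, hall, ?_⟩
  · rintro rfl
    have h := (hFI ⟨eOp K 0 0, eOp_mem K 0 0⟩).2 (Submodule.subset_span ⟨(0, 0), rfl⟩)
    rw [TwoSidedIdeal.mem_bot] at h
    have h2 := congrArg Subtype.val h
    have h3 := eOp_pz K 0 0 0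
    simp only [ZeroMemClass.coe_zero] at h2
    rw [h2] at h3
    exact pz_ne K 0 (by simpa using h3.symm)
  · have hk : ∀ x : I1 K, FI.ringCon.mk' x = 0 ↔ x ∈ FI := by
      intro x
      rw [TwoSidedIdeal.mem_iff]
      exact FI.ringCon.eq
    have hsurj : Function.Surjective FI.ringCon.mk' := FI.ringCon.mk'_surjective
    have hnt : Nontrivial FI.ringCon.Quotient := by
      refine ⟨0, 1, fun h => h1 ?_⟩
      rw [← hk, map_one, ← h]
    constructor
    refine { eq_bot_or_eq_top := ?_ }
    intro I
    have hle : ∀ x, x ∈ I.comap FI.ringCon.mk' ↔ FI.ringCon.mk' x ∈ I := fun x =>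
      TwoSidedIdeal.mem_comap _
    rcases (or_assoc.2 (hall (I.comap FI.ringCon.mk'))) with h | h
    · left
      rw [eq_bot_iff]
      intro y hy
      obtain ⟨x, rfl⟩ := hsurj y
      have hx := (hle x).2 hy
      have : x ∈ FI := by
        rcases h with h | h
        · rw [h, TwoSidedIdeal.mem_bot] at hx
          rw [hx]; exact zero_mem _
        · rwa [h] at hx
      rw [(hk x).2 this]
      exact zero_mem _
    · right
      rw [eq_top_iff]
      intro y _
      obtain ⟨x, rfl⟩ := hsurj y
      rw [← hle, h]
      exact (TwoSidedIdeal.mem_top _)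


end
end

section
/- For every integer n ≥ 2 there exists an injective K-algebra endomorphism σ_n of the quotient algebra B_1 := I_1/F satisfying σ_n(H̄) = (1/n)·H̄ and σ_n(∂̄) = ∂̄^n (where H̄, ∂̄ denote the images of H, ∂ in B_1), and σ_n is not surjective. In particular, the analogue of the Dixmier conjecture fails for B_1: B_1 admits an algebra endomorphism that is not an automorphism. -/
set_option linter.unusedSectionVars false

open Polynomial

noncomputable section

variable (K : Type*) [Field K] [CharZero K]

set_option synthInstance.maxHeartbeats 400000
set_option maxHeartbeats 1000000

/-- The `K`-algebra structure on the quotient `B₁ = I₁/F` (for a two-sided ideal `FI`). -/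
def B1Algebra (FI : TwoSidedIdeal (I1 K)) : Algebra K FI.ringCon.Quotient :=
  RingHom.toAlgebra' ((RingCon.mk' FI.ringCon).comp (algebraMap K (I1 K)))
    (fun c x => by
      induction x using Quotient.ind with
      | _ a =>
        show (↑(algebraMap K (I1 K) c) : FI.ringCon.Quotient) * ↑a =
          ↑a * ↑(algebraMap K (I1 K) c)
        rw [← RingCon.coe_mul, ← RingCon.coe_mul, Algebra.commutes])

/-- the operator `δ_q ↦ f(q) δ_{q+k}` on finitely supported functions on `K` -/
def mOp (k : ℤ) (f : K[X]) : Module.End K (K →₀ K) :=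
  Finsupp.lsum K fun q => (f.eval q) • Finsupp.lsingle (q + (k : K))

lemma mOp_single (k : ℤ) (f : K[X]) (q c : K) :
    mOp K k f (Finsupp.single q c) = Finsupp.single (q + k) (f.eval q * c) := by
  simp [mOp]

lemma mOp_mul (k l : ℤ) (f g : K[X]) :
    mOp K k f * mOp K l g = mOp K (k + l) (f.comp (X + C (l : K)) * g) := by
  refine Finsupp.lhom_ext fun q c => ?_
  rw [Module.End.mul_apply, mOp_single, mOp_single, mOp_single]
  simp only [eval_mul, eval_comp, eval_add, eval_X, eval_C, Int.cast_add]
  congr 1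
  · ring
  · ring

lemma mOp_one : mOp K 0 1 = 1 := by
  refine Finsupp.lhom_ext fun q c => ?_
  simp [mOp_single]

/-- the span of the `mOp` -/
def Csub : Submodule K (Module.End K (K →₀ K)) :=
  Submodule.span K (Set.range fun p : ℤ × K[X] => mOp K p.1 p.2)

lemma mOp_mem (k : ℤ) (f : K[X]) : mOp K k f ∈ Csub K := Submodule.subset_span ⟨(k, f), rfl⟩

lemma Csub_mul (S T : Module.End K (K →₀ K)) (hS : S ∈ Csub K) (hT : T ∈ Csub K) :
    S * T ∈ Csub K := by
  have h : Csub K * Csub K ≤ Csub K := by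
    unfold Csub
    rw [Submodule.span_mul_span, Submodule.span_le]
    rintro _ ⟨_, ⟨⟨k, f⟩, rfl⟩, _, ⟨⟨l, g⟩, rfl⟩, rfl⟩
    simp only [mOp_mul]
    exact mOp_mem K _ _
  exact h (Submodule.mul_mem_mul hS hT)

lemma Csub_prop (T : Module.End K (K →₀ K)) (hT : T ∈ Csub K) :
    (∃ p : ℤ → K[X], ∀ q k, T (Finsupp.single q 1) (q + (k : ℤ)) = (p k).eval q) ∧
    (∀ q r : K, (∀ k : ℤ, r ≠ q + k) → T (Finsupp.single q 1) r = 0) := by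
  classical
  unfold Csub at hT
  induction hT using Submodule.span_induction with
  | mem x h =>
    obtain ⟨⟨k, f⟩, rfl⟩ := h
    constructor
    · refine ⟨fun l => if k = l then f else 0, fun q l => ?_⟩
      simp only [mOp_single, Finsupp.single_apply]
      by_cases h : k = l <;> simp [h]
    · intro q r h
      simp only [mOp_single, Finsupp.single_apply]
      rw [if_neg (fun h' => h k h'.symm)]
  | zero => exact ⟨⟨0, by simp⟩, by simp⟩
  | add x y _ _ hx hy =>
    obtain ⟨⟨p, hp⟩, hx⟩ := hx
    obtain ⟨⟨p', hp'⟩, hy⟩ := hy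
    refine ⟨⟨p + p', fun q k => by simp [hp, hp']⟩, fun q r h => ?_⟩
    simp [hx q r h, hy q r h]
  | smul c x _ hx =>
    obtain ⟨⟨p, hp⟩, hx⟩ := hx
    refine ⟨⟨fun k => C c * p k, fun q k => by simp [hp]⟩, fun q r h => ?_⟩
    simp [hx q r h]

lemma Csub_zero (T : Module.End K (K →₀ K)) (hT : T ∈ Csub K) (N : ℕ)
    (h : ∀ m : ℕ, N ≤ m → T (Finsupp.single ((m : K) + 1) 1) = 0) : T = 0 := by
  obtain ⟨⟨p, hp⟩, h2⟩ := Csub_prop K T hT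
  have hp0 : ∀ k, p k = 0 := by
    intro k
    apply Polynomial.eq_zero_of_infinite_isRoot
    have hinj : Function.Injective (fun m : ℕ => (((m + N : ℕ) : K) + 1)) := by
      intro a b hab
      simpa using hab
    refine (Set.infinite_range_of_injective hinj).mono ?_
    rintro _ ⟨m, rfl⟩
    show (p k).eval _ = 0
    rw [← hp, h _ (by omega)]
    rfl
  have h3 : ∀ q, T (Finsupp.single q 1) = 0 := by
    intro q
    ext r
    by_cases hr : ∃ k : ℤ, r = q + k
    · obtain ⟨k, rfl⟩ := hr
      rw [hp, hp0]; simp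
    · push Not at hr
      exact h2 q r hr
  refine Finsupp.lhom_ext fun q c => ?_
  have : (Finsupp.single q c : K →₀ K) = c • Finsupp.single q 1 := by simp
  rw [this, map_smul, h3]; simp

/-- embedding of `K[x]` -/
def jmap : K[X] →ₗ[K] (K →₀ K) :=
  Polynomial.lsum fun m => (m.factorial : K) • Finsupp.lsingle ((m : K) + 1)

lemma jmap_monomial (m : ℕ) (c : K) :
    jmap K (monomial m c) = Finsupp.single ((m : K) + 1) (m.factorial * c) := by
  simp [jmap, Polynomial.lsum, Polynomial.sum_monomial_index]

lemma jmap_apply (p : K[X]) (m : ℕ) : jmap K p ((m : K) + 1) = m.factorial * p.coeff m := by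
  classical
  induction p using Polynomial.induction_on' with
  | add p q hp hq => simp [hp, hq, mul_add]
  | monomial k c =>
    rw [jmap_monomial, Finsupp.single_apply, coeff_monomial]
    by_cases h : k = m <;> simp [h]

lemma jmap_inj (p : K[X]) (h : jmap K p = 0) : p = 0 := by
  ext m
  have := jmap_apply K p m
  rw [h] at this
  have h2 : (m.factorial : K) ≠ 0 := by exact_mod_cast m.factorial_ne_zero
  simpa [h2] using this.symm

/-- `x^N K[x]` -/
def Pfil (N : ℕ) : Submodule K K[X] :=
  Submodule.span K {p | ∃ m, N ≤ m ∧ p = monomial m 1}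

lemma mono_mem (N m : ℕ) (h : N ≤ m) (c : K) : monomial m c ∈ Pfil K N := by
  have : monomial m c = c • monomial m (1 : K) := by simp [smul_monomial]
  rw [this]
  exact Submodule.smul_mem _ _ (Submodule.subset_span ⟨m, h, rfl⟩)

lemma Pfil_anti {M N : ℕ} (h : M ≤ N) : Pfil K N ≤ Pfil K M := by
  apply Submodule.span_mono
  rintro _ ⟨m, hm, rfl⟩
  exact ⟨m, h.trans hm, rfl⟩

lemma Pfil_map (a : Module.End K K[X]) (M N : ℕ)
    (h : ∀ m, M ≤ m → a (monomial m 1) ∈ Pfil K N) : ∀ p ∈ Pfil K M, a p ∈ Pfil K N := by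
  have : Pfil K M ≤ (Pfil K N).comap a := by
    unfold Pfil
    rw [Submodule.span_le]
    rintro _ ⟨m, hm, rfl⟩
    exact h m hm
  exact this

lemma Pfil_eq {V : Type*} [AddCommGroup V] [Module K V] (a b : K[X] →ₗ[K] V) (M : ℕ)
    (h : ∀ m, M ≤ m → a (monomial m 1) = b (monomial m 1)) : ∀ p ∈ Pfil K M, a p = b p := by
  have : Set.EqOn a b (Pfil K M) := by
    apply LinearMap.eqOn_span
    rintro _ ⟨m, hm, rfl⟩
    exact h m hm
  exact this

/-- pairs of asymptotically equal operators -/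
def Gsub : Subalgebra K (Module.End K K[X] × Module.End K (K →₀ K)) where
  carrier := {x | (∀ N, ∃ M, ∀ p ∈ Pfil K M, x.1 p ∈ Pfil K N) ∧
    (∃ N, ∀ p ∈ Pfil K N, jmap K (x.1 p) = x.2 (jmap K p)) ∧ x.2 ∈ Csub K}
  mul_mem' := by
    rintro ⟨a, S⟩ ⟨b, T⟩ ⟨ha, ⟨N, hN⟩, hS⟩ ⟨hb, ⟨N', hN'⟩, hT⟩
    refine ⟨fun L => ?_, ?_, Csub_mul K _ _ hS hT⟩
    · obtain ⟨M, hM⟩ := ha L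
      obtain ⟨M', hM'⟩ := hb M
      exact ⟨M', fun p hp => hM _ (hM' _ hp)⟩
    · obtain ⟨M, hM⟩ := hb N
      refine ⟨max M N', fun p hp => ?_⟩
      have h1 := hN _ (hM p (Pfil_anti K (le_max_left _ _) hp))
      have h2 := hN' p (Pfil_anti K (le_max_right _ _) hp)
      simp only at h1 h2
      simp only [Prod.mk_mul_mk, Module.End.mul_apply, h1, h2]
  add_mem' := by
    rintro ⟨a, S⟩ ⟨b, T⟩ ⟨ha, ⟨N, hN⟩, hS⟩ ⟨hb, ⟨N', hN'⟩, hT⟩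
    refine ⟨fun L => ?_, ?_, add_mem hS hT⟩
    · obtain ⟨M, hM⟩ := ha L
      obtain ⟨M', hM'⟩ := hb L
      exact ⟨max M M', fun p hp => add_mem (hM _ (Pfil_anti K (le_max_left _ _) hp))
        (hM' _ (Pfil_anti K (le_max_right _ _) hp))⟩
    · refine ⟨max N N', fun p hp => ?_⟩
      have h1 := hN _ (Pfil_anti K (le_max_left _ _) hp)
      have h2 := hN' p (Pfil_anti K (le_max_right _ _) hp)
      simp only at h1 h2
      simp only [Prod.mk_add_mk, LinearMap.add_apply, map_add, h1, h2]
  algebraMap_mem' := by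
    intro c
    refine ⟨fun L => ⟨L, fun p hp => ?_⟩, ⟨0, fun p hp => ?_⟩, ?_⟩
    · simpa using Submodule.smul_mem _ c hp
    · simp
    · show algebraMap K (Module.End K (K →₀ K)) c ∈ Csub K
      rw [Algebra.algebraMap_eq_smul_one, ← mOp_one]
      exact Submodule.smul_mem _ _ (mOp_mem K _ _)

lemma Gsub_zero (T : Module.End K (K →₀ K)) (a : Module.End K K[X]) (N : ℕ)
    (ha : ∀ p ∈ Pfil K N, a p = 0) (h : (a, T) ∈ Gsub K) : T = 0 := by
  obtain ⟨-, ⟨M, hM⟩, hC⟩ := h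
  refine Csub_zero K T hC (max M N) fun m hm => ?_
  have h1 := hM (monomial m 1) (mono_mem K _ _ (by omega) _)
  have h2 := ha (monomial m 1) (mono_mem K _ _ (by omega) _)
  simp only [h2, map_zero, jmap_monomial, mul_one] at h1
  have h3 : (m.factorial : K) ≠ 0 := by exact_mod_cast m.factorial_ne_zero
  have h4 : (Finsupp.single ((m : K) + 1) (m.factorial : K)) =
    (m.factorial : K) • Finsupp.single ((m : K) + 1) (1 : K) := by simp
  rw [h4, map_smul] at h1
  exact (smul_eq_zero.mp h1.symm).resolve_left h3

lemma intOp_monomial (m : ℕ) (c : K) :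
    intOp K (monomial m c) = monomial (m + 1) (((m : K) + 1)⁻¹ * c) := by
  simp [intOp, Polynomial.lsum, Polynomial.sum_monomial_index, smul_monomial]

lemma derOp_monomial (m : ℕ) (c : K) :
    derOp K (monomial m c) = monomial (m - 1) (c * m) := by
  simp [derOp, derivative_monomial]

lemma xOp_monomial (m : ℕ) (c : K) :
    xOp K (monomial m c) = monomial (m + 1) c := by
  simp [xOp, X_mul_monomial]

lemma Gsub_x : (xOp K, mOp K 1 X) ∈ Gsub K := by
  refine ⟨fun N => ⟨N, Pfil_map K _ _ _ fun m hm => ?_⟩,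
    ⟨0, Pfil_eq K (jmap K ∘ₗ xOp K) (mOp K 1 X ∘ₗ jmap K) _ fun m hm => ?_⟩, mOp_mem K _ _⟩
  · rw [xOp_monomial]; exact mono_mem K _ _ (by omega) _
  · simp only [LinearMap.comp_apply, xOp_monomial, jmap_monomial, mOp_single]
    simp [Nat.factorial_succ]

lemma Gsub_int : (intOp K, mOp K 1 1) ∈ Gsub K := by
  refine ⟨fun N => ⟨N, Pfil_map K _ _ _ fun m hm => ?_⟩,
    ⟨0, Pfil_eq K (jmap K ∘ₗ intOp K) (mOp K 1 1 ∘ₗ jmap K) _ fun m hm => ?_⟩, mOp_mem K _ _⟩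
  · rw [intOp_monomial]; exact mono_mem K _ _ (by omega) _
  · simp only [LinearMap.comp_apply, intOp_monomial, jmap_monomial, mOp_single]
    have : (m : K) + 1 ≠ 0 := by exact_mod_cast m.succ_ne_zero
    have h2 : ((m + 1).factorial : K) * (((m : K) + 1)⁻¹ * 1) = m.factorial := by
      rw [Nat.factorial_succ]; push_cast; field_simp
    rw [h2]
    simp [-Finsupp.single_mul]

lemma Gsub_der : (derOp K, mOp K (-1) 1) ∈ Gsub K := by
  refine ⟨fun N => ⟨N + 1, Pfil_map K _ _ _ fun m hm => ?_⟩,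
    ⟨1, Pfil_eq K (jmap K ∘ₗ derOp K) (mOp K (-1) 1 ∘ₗ jmap K) _ fun m hm => ?_⟩, mOp_mem K _ _⟩
  · rw [derOp_monomial]; exact mono_mem K _ _ (by omega) _
  · simp only [LinearMap.comp_apply, derOp_monomial, jmap_monomial, mOp_single]
    obtain ⟨k, rfl⟩ : ∃ k, m = k + 1 := ⟨m - 1, by omega⟩
    simp [Nat.factorial_succ, mul_comm]

lemma exists_lift (a : I1 K) : ∃ T, ((a : Module.End K K[X]), T) ∈ Gsub K := by
  have h : I1 K ≤ (Gsub K).map (AlgHom.fst K _ _) := by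
    unfold I1
    rw [Algebra.adjoin_le_iff]
    rintro _ (rfl | rfl | rfl)
    · exact ⟨_, Gsub_x K, rfl⟩
    · exact ⟨_, Gsub_der K, rfl⟩
    · exact ⟨_, Gsub_int K, rfl⟩
  obtain ⟨⟨b, T⟩, hb, rfl : b = a⟩ := h a.2
  exact ⟨T, hb⟩

lemma Gsub_unique (a : Module.End K K[X]) (S T : Module.End K (K →₀ K))
    (hS : (a, S) ∈ Gsub K) (hT : (a, T) ∈ Gsub K) : S = T := by
  have h : (a - a, S - T) ∈ Gsub K := by
    have h1 := (Gsub K).add_mem hS ((Gsub K).smul_mem hT (-1))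
    have e1 : a - a = a + (-1 : K) • a := LinearMap.ext fun v => by simp
    have e2 : S - T = S + (-1 : K) • T := LinearMap.ext fun v => by simp [sub_eq_add_neg]
    rw [e1, e2]
    exact h1
  exact sub_eq_zero.mp (Gsub_zero K _ _ 0 (by simp) h)

/-- the function underlying `psi` -/
def psiF (a : I1 K) : Module.End K (K →₀ K) := (exists_lift K a).choose

lemma psiF_spec (a : I1 K) : ((a : Module.End K K[X]), psiF K a) ∈ Gsub K :=
  (exists_lift K a).choose_spec

lemma psiF_eq (a : I1 K) (T) (h : ((a : Module.End K K[X]), T) ∈ Gsub K) : psiF K a = T :=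
  Gsub_unique K _ _ _ (psiF_spec K a) h

lemma psiF_add (a b : I1 K) : psiF K (a + b) = psiF K a + psiF K b := by
  apply psiF_eq
  have := add_mem (psiF_spec K a) (psiF_spec K b)
  rwa [Prod.mk_add_mk] at this

lemma psiF_mul (a b : I1 K) : psiF K (a * b) = psiF K a * psiF K b := by
  apply psiF_eq
  have := mul_mem (psiF_spec K a) (psiF_spec K b)
  rwa [Prod.mk_mul_mk] at this

lemma psiF_algebraMap (c : K) : psiF K (algebraMap K (I1 K) c) = algebraMap K _ c := by
  apply psiF_eq
  exact (Gsub K).algebraMap_mem c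

/-- the representation of `I₁` -/
def psi : I1 K →ₐ[K] Module.End K (K →₀ K) where
  toFun := psiF K
  map_one' := by
    have := psiF_algebraMap K 1
    rwa [map_one, map_one] at this
  map_zero' := by
    have := psiF_algebraMap K 0
    rwa [map_zero, map_zero] at this
  map_add' := psiF_add K
  map_mul' := psiF_mul K
  commutes' := psiF_algebraMap K

lemma psi_spec (a : I1 K) : ((a : Module.End K K[X]), psi K a) ∈ Gsub K :=
  psiF_spec K a

lemma psi_eq (a : I1 K) (T) (h : ((a : Module.End K K[X]), T) ∈ Gsub K) : psi K a = T :=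
  Gsub_unique K _ _ _ (psi_spec K a) h

lemma intOp_pow_C (i : ℕ) (c : K) :
    (intOp K ^ i) (monomial 0 c) = monomial i ((i.factorial : K)⁻¹ * c) := by
  induction i with
  | zero => simp
  | succ i ih =>
    rw [pow_succ', Module.End.mul_apply, ih, intOp_monomial]
    simp [Nat.factorial_succ, mul_assoc, mul_left_comm]

lemma eOp_zero (p : K[X]) : p - intOp K (derOp K p) = monomial 0 (p.coeff 0) := by
  induction p using Polynomial.induction_on' with
  | add p q hp hq => simp only [map_add, coeff_add]; rw [← hp, ← hq]; abel
  | monomial k c =>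
    rw [derOp_monomial, intOp_monomial]
    rcases k with _ | k
    · simp
    · have : (k : K) + 1 ≠ 0 := by exact_mod_cast k.succ_ne_zero
      have h2 : ((k : K) + 1)⁻¹ * (c * (k + 1)) = c := by field_simp
      simp [h2]

lemma eOp_apply (i j : ℕ) (p : K[X]) :
    eOp K i j p = monomial i ((i.factorial : K)⁻¹ * (j.factorial * p.coeff j)) := by
  have h : eOp K i j = intOp K ^ i * (1 - intOp K * derOp K) * derOp K ^ j := by
    rw [eOp, pow_succ, pow_succ', mul_sub, mul_one, sub_mul]
    simp only [mul_assoc]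
  have h2 : ((derOp K ^ j) p).coeff 0 = j.factorial * p.coeff j := by
    rw [Module.End.pow_apply]
    show (derivative^[j] p).coeff 0 = _
    rw [coeff_iterate_derivative]
    simp [Nat.descFactorial_self]
  rw [h, Module.End.mul_apply, Module.End.mul_apply, LinearMap.sub_apply, Module.End.mul_apply,
    Module.End.one_apply, eOp_zero, intOp_pow_C, h2]

lemma rank_one_mem (j : ℕ) (p : K[X]) : (lcoeff K j).smulRight p ∈ Fspan K := by
  induction p using Polynomial.induction_on' with
  | add p q hp hq =>
    have : (lcoeff K j).smulRight (p + q) =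
      (lcoeff K j).smulRight p + (lcoeff K j).smulRight q := by ext; simp
    rw [this]; exact add_mem hp hq
  | monomial i c =>
    have : (lcoeff K j).smulRight (monomial i c) =
        (c * i.factorial * (j.factorial : K)⁻¹) • eOp K i j := by
      refine LinearMap.ext fun p => ?_
      have h1 : (i.factorial : K) ≠ 0 := by exact_mod_cast i.factorial_ne_zero
      have h2 : (j.factorial : K) ≠ 0 := by exact_mod_cast j.factorial_ne_zero
      rw [LinearMap.smul_apply, eOp_apply, smul_monomial, LinearMap.smulRight_apply,
        smul_monomial]
      congr 1
      simp only [lcoeff_apply, smul_eq_mul]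
      field_simp
    rw [this]
    exact Submodule.smul_mem _ _ (Submodule.subset_span ⟨(i, j), rfl⟩)

lemma mem_Fspan_of (a : Module.End K K[X]) (N : ℕ) (h : ∀ p ∈ Pfil K N, a p = 0) :
    a ∈ Fspan K := by
  have : a = ∑ j ∈ Finset.range N, (lcoeff K j).smulRight (a (monomial j 1)) := by
    refine Polynomial.lhom_ext' fun m => LinearMap.ext_ring ?_
    simp only [LinearMap.comp_apply, LinearMap.sum_apply, LinearMap.smulRight_apply,
      lcoeff_apply, coeff_monomial]
    by_cases hm : m < N
    · simp [hm]
    · simp [hm, h _ (mono_mem K N m (by omega) 1)]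
  rw [this]
  exact sum_mem fun j _ => rank_one_mem K j _

lemma Fspan_kill (a : Module.End K K[X]) (h : a ∈ Fspan K) :
    ∃ N, ∀ p ∈ Pfil K N, a p = 0 := by
  unfold Fspan at h
  induction h using Submodule.span_induction with
  | mem x h =>
    obtain ⟨⟨i, j⟩, rfl⟩ := h
    refine ⟨j + 1, Pfil_eq K _ 0 _ fun m hm => ?_⟩
    simp only [eOp_apply, coeff_monomial]
    rw [if_neg (by omega)]
    simp
  | zero => exact ⟨0, by simp⟩
  | add x y _ _ hx hy =>
    obtain ⟨M, hM⟩ := hx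
    obtain ⟨N, hN⟩ := hy
    refine ⟨max M N, fun p hp => ?_⟩
    rw [LinearMap.add_apply, hM _ (Pfil_anti K (le_max_left _ _) hp),
      hN _ (Pfil_anti K (le_max_right _ _) hp), add_zero]
  | smul c x _ hx =>
    obtain ⟨M, hM⟩ := hx
    exact ⟨M, fun p hp => by simp [hM p hp]⟩

lemma psi_zero_iff (a : I1 K) : psi K a = 0 ↔ (a : Module.End K K[X]) ∈ Fspan K := by
  constructor
  · intro h
    obtain ⟨-, ⟨N, hN⟩, -⟩ := psi_spec K a
    refine mem_Fspan_of K _ N fun p hp => jmap_inj K _ ?_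
    rw [hN p hp]
    simp [h]
  · intro h
    obtain ⟨N, hN⟩ := Fspan_kill K _ h
    exact Gsub_zero K _ _ N hN (psi_spec K a)

/-- dilation -/
def dil (n : ℕ) (hn : n ≠ 0) : (K →₀ K) ≃ₗ[K] (K →₀ K) :=
  Finsupp.domLCongr (Equiv.mulRight₀ (n : K) (by exact_mod_cast hn))

/-- conjugation by dilation -/
def conjD (n : ℕ) (hn : n ≠ 0) : Module.End K (K →₀ K) ≃ₐ[K] Module.End K (K →₀ K) :=
  LinearEquiv.conjAlgEquiv K (dil K n hn)

lemma conjD_mOp (n : ℕ) (hn : n ≠ 0) (k : ℤ) (f : K[X]) :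
    conjD K n hn (mOp K k f) = mOp K (k * n) (f.comp (C (n : K)⁻¹ * X)) := by
  have hn' : (n : K) ≠ 0 := by exact_mod_cast hn
  refine Finsupp.lhom_ext fun q c => ?_
  have h1 : (dil K n hn).symm (Finsupp.single q c) = Finsupp.single ((n : K)⁻¹ * q) c := by
    rw [LinearEquiv.symm_apply_eq]
    simp [dil]
    field_simp
  show dil K n hn (mOp K k f ((dil K n hn).symm (Finsupp.single q c))) = _
  rw [h1, mOp_single, mOp_single]
  simp only [dil, Finsupp.domLCongr_single, Equiv.mulRight₀_apply, eval_comp, eval_mul, eval_C,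
    eval_X, Int.cast_mul, Int.cast_natCast]
  congr 1
  field_simp

lemma mOp_pow (k : ℤ) (n : ℕ) : mOp K k 1 ^ n = mOp K (k * n) 1 := by
  induction n with
  | zero => simp [mOp_one]
  | succ n ih => rw [pow_succ, ih, mOp_mul]; congr 1; push_cast; ring; simp

lemma conjD_nonsurj (n : ℕ) (hn : 2 ≤ n) (T : Module.End K (K →₀ K)) (hT : T ∈ Csub K) :
    conjD K n (by omega) T ≠ mOp K (-1) 1 := by
  intro h
  have h' : T = (conjD K n (by omega)).symm (mOp K (-1) 1) := by rw [← h]; simp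
  have hn' : (n : K) ≠ 0 := by exact_mod_cast (by omega : n ≠ 0)
  have h2 := (Csub_prop K T hT).2 0 (-(n : K)⁻¹) (by
    intro k hk
    have h3 : (((k * n : ℤ)) : K) = ((-1 : ℤ) : K) := by
      push_cast
      rw [zero_add] at hk
      rw [← hk]; field_simp
    have h4 : k * n = -1 := by exact_mod_cast h3
    have h5 : (n : ℤ) ∣ 1 := ⟨-k, by linarith⟩
    have := Int.le_of_dvd one_pos h5
    omega)
  have h6 : conjD K n (by omega) T (Finsupp.single 0 1) = Finsupp.single (-1) 1 := by
    rw [h, mOp_single]; simp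
  have h7 : (dil K n (by omega)).symm (Finsupp.single 0 1) = Finsupp.single 0 1 := by
    rw [LinearEquiv.symm_apply_eq]
    simp [dil]
  have h8 : dil K n (by omega) (T ((dil K n (by omega)).symm (Finsupp.single 0 1)))
    = Finsupp.single (-1) 1 := h6
  rw [h7, ← LinearEquiv.eq_symm_apply] at h8
  have h9 : (dil K n (by omega)).symm (Finsupp.single (-1) 1) = Finsupp.single (-(n : K)⁻¹) 1 := by
    rw [LinearEquiv.symm_apply_eq]
    simp [dil, hn']
  rw [h8, h9] at h2
  simp at h2

/-- the multiplication operator as an element of `I₁` -/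
def XelI : I1 K := ⟨xOp K, xOp_mem K⟩

lemma psi_X : psi K (XelI K) = mOp K 1 X := psi_eq K _ _ (Gsub_x K)
lemma psi_D : psi K (DelI K) = mOp K (-1) 1 := psi_eq K _ _ (Gsub_der K)
lemma psi_I : psi K (IntI K) = mOp K 1 1 := psi_eq K _ _ (Gsub_int K)
lemma psi_H : psi K (HelI K) = mOp K 0 X := by
  have : HelI K = DelI K * XelI K := rfl
  rw [this, map_mul, psi_X, psi_D, mOp_mul]
  simp

lemma smul_mOp (c : K) (k : ℤ) (f : K[X]) : c • mOp K k f = mOp K k (C c * f) := by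
  refine Finsupp.lhom_ext fun q d => ?_
  simp [mOp_single, mul_assoc, -Finsupp.single_mul]

lemma conjD_range (n : ℕ) (hn : n ≠ 0) (a : I1 K) :
    ∃ b : I1 K, psi K b = conjD K n hn (psi K a) := by
  have hn' : (n : K) ≠ 0 := by exact_mod_cast hn
  have key : Algebra.adjoin K {xOp K, derOp K, intOp K} ≤
      (((psi K).range.comap (conjD K n hn).toAlgHom).comap (psi K)).map (I1 K).val := by
    rw [Algebra.adjoin_le_iff]
    rintro _ (rfl | rfl | rfl)
    · refine ⟨XelI K, ⟨IntI K ^ n * ((n : K)⁻¹ • HelI K), ?_⟩, rfl⟩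
      show psi K _ = conjD K n hn (psi K (XelI K))
      rw [map_mul, map_pow, map_smul, psi_X, psi_I, psi_H, conjD_mOp, mOp_pow, smul_mOp, mOp_mul]
      simp
    · refine ⟨DelI K, ⟨DelI K ^ n, ?_⟩, rfl⟩
      show psi K _ = conjD K n hn (psi K (DelI K))
      rw [map_pow, psi_D, conjD_mOp, mOp_pow]
      simp
    · refine ⟨IntI K, ⟨IntI K ^ n, ?_⟩, rfl⟩
      show psi K _ = conjD K n hn (psi K (IntI K))
      rw [map_pow, psi_I, conjD_mOp, mOp_pow]
      simp
  obtain ⟨a', ⟨b, hb⟩, h⟩ := key a.2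
  have : a' = a := Subtype.ext h
  subst this
  exact ⟨b, hb⟩

lemma factor_exists {B E : Type*} [Semiring B] [Semiring E] [Algebra K B] [Algebra K E]
    (ψ : B →ₐ[K] E) (hψ : Function.Injective ψ) (c : E →ₐ[K] E)
    (h : ∀ b, ∃ b', ψ b' = c (ψ b)) : ∃ σ : B →ₐ[K] B, ∀ b, ψ (σ b) = c (ψ b) := by
  let e := AlgEquiv.ofInjective ψ hψ
  refine ⟨(e.symm : _ →ₐ[K] B).comp ((c.comp ψ).codRestrict ψ.range h), fun b => ?_⟩
  have := e.apply_symm_apply ((c.comp ψ).codRestrict ψ.range h b)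
  exact congrArg Subtype.val this

/-- For every `n ≥ 2` there is an injective `K`-algebra endomorphism
`σₙ` of `B₁ := I₁/F` with `σₙ(H̄) = (1/n)•H̄` and `σₙ(∂̄) = ∂̄ⁿ`, and `σₙ` is not
surjective; so the analogue of the Dixmier conjecture fails for `B₁`. -/
theorem dixmier_conjecture_fails_for_B1
    (FI : TwoSidedIdeal (I1 K))
    (hFI : ∀ a : I1 K, a ∈ FI ↔ (a : Module.End K (Polynomial K)) ∈ Fspan K)
    (n : ℕ) (hn : 2 ≤ n) :
    letI := B1Algebra K FI
    ∃ σ : FI.ringCon.Quotient →ₐ[K] FI.ringCon.Quotient,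
      Function.Injective σ ∧
      σ (RingCon.mk' FI.ringCon (HelI K)) = RingCon.mk' FI.ringCon ((n : K)⁻¹ • HelI K) ∧
      σ (RingCon.mk' FI.ringCon (DelI K)) = (RingCon.mk' FI.ringCon (DelI K)) ^ n ∧
      ¬ Function.Surjective σ := by
  letI := B1Algebra K FI
  have hn0 : n ≠ 0 := by omega
  have hker : ∀ a b : I1 K, FI.ringCon a b ↔ psi K a = psi K b := by
    intro a b
    rw [TwoSidedIdeal.rel_iff, hFI, ← psi_zero_iff, map_sub, sub_eq_zero]
  let ψr : FI.ringCon.Quotient →+* Module.End K (K →₀ K) :=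
    RingCon.lift FI.ringCon (psi K).toRingHom (fun a b h => (hker a b).1 h)
  have hψr : ∀ a, ψr (RingCon.mk' FI.ringCon a) = psi K a := fun a => rfl
  let ψ : FI.ringCon.Quotient →ₐ[K] Module.End K (K →₀ K) :=
    { ψr with
      commutes' := fun c => (psi K).commutes c }
  have hψ : ∀ a, ψ (RingCon.mk' FI.ringCon a) = psi K a := fun a => rfl
  have hsurj : Function.Surjective (RingCon.mk' FI.ringCon) := RingCon.mk'_surjective _
  have hinj : Function.Injective ψ := by
    intro x y hxy
    obtain ⟨a, rfl⟩ := hsurj x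
    obtain ⟨b, rfl⟩ := hsurj y
    rw [hψ, hψ] at hxy
    exact (RingCon.eq _).2 ((hker a b).2 hxy)
  have hr : ∀ x, ∃ y, ψ y = (conjD K n hn0).toAlgHom (ψ x) := by
    intro x
    obtain ⟨a, rfl⟩ := hsurj x
    obtain ⟨b, hb⟩ := conjD_range K n hn0 a
    exact ⟨RingCon.mk' FI.ringCon b, hb⟩
  obtain ⟨σ, hσ⟩ := factor_exists K (B := FI.ringCon.Quotient) ψ hinj (conjD K n hn0).toAlgHom hr
  have hσ' : ∀ b, ψ (σ b) = conjD K n hn0 (ψ b) := hσ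
  refine ⟨σ, ?_, ?_, ?_, ?_⟩
  · intro x y hxy
    apply hinj
    apply (conjD K n hn0).injective
    rw [← hσ', ← hσ', hxy]
  · apply hinj
    rw [hσ', hψ, hψ, map_smul, psi_H, conjD_mOp, smul_mOp]
    simp
  · apply hinj
    rw [hσ', map_pow, hψ, psi_D, conjD_mOp, mOp_pow]
    simp
  · intro hs
    obtain ⟨x, hx⟩ := hs (RingCon.mk' FI.ringCon (DelI K))
    obtain ⟨a, rfl⟩ := hsurj x
    have h1 := hσ' (RingCon.mk' FI.ringCon a)
    rw [hx, hψ, hψ, psi_D] at h1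
    exact conjD_nonsurj K n hn _ (psi_spec K a).2.2 h1.symm

end
end

section
/- The set of eigenvalues of the inner derivation ad(H) : I_1 → I_1, a ↦ Ha − aH, is exactly the set of integers: (i) for every integer m there exists a nonzero a ∈ I_1 with Ha − aH = m·a; and (ii) if a ∈ I_1 is nonzero, ν ∈ K, and Ha − aH = ν·a, then ν is an integer (i.e., ν lies in the image of ℤ in K). -/
set_option linter.unusedSectionVars false

open Polynomial

noncomputable section

variable (K : Type*) [Field K] [CharZero K]

set_option synthInstance.maxHeartbeats 400000
set_option maxHeartbeats 1000000

lemma coeff_Hop_aux (p : Polynomial K) (k : ℕ) :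
    (Hop K p).coeff k = ((k : K) + 1) * p.coeff k := by
  have h : Hop K p = Polynomial.derivative (Polynomial.X * p) := rfl
  rw [h, Polynomial.coeff_derivative, Polynomial.coeff_X_mul, mul_comm]

lemma Hop_monomial_aux (n : ℕ) :
    Hop K (Polynomial.monomial n 1) = ((n : K) + 1) • Polynomial.monomial n 1 := by
  ext k
  rw [coeff_Hop_aux, Polynomial.coeff_smul, Polynomial.coeff_monomial, smul_eq_mul]
  split_ifs with h
  · rw [h]
  · simp

lemma ad_pow_aux {R : Type*} [Ring R] (h a : R) (c : ℤ) (e : h * a - a * h = c • a) (m : ℕ) :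
    h * a ^ m - a ^ m * h = ((m : ℤ) * c) • a ^ m := by
  induction m with
  | zero => simp
  | succ m ih =>
    have : h * a ^ (m + 1) - a ^ (m + 1) * h
        = (h * a ^ m - a ^ m * h) * a + a ^ m * (h * a - a * h) := by
      rw [pow_succ]; noncomm_ring
    rw [this, ih, e, pow_succ, smul_mul_assoc, mul_smul_comm, ← add_smul]
    congr 1
    push_cast
    ring

lemma ad_x_aux : Hop K * xOp K - xOp K * Hop K = (1 : ℤ) • xOp K := by
  refine LinearMap.ext fun p => ?_
  change Polynomial.derivative (X * (X * p)) - X * Polynomial.derivative (X * p)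
    = (1 : ℤ) • (X * p)
  simp [Polynomial.derivative_mul]

lemma ad_d_aux : Hop K * derOp K - derOp K * Hop K = (-1 : ℤ) • derOp K := by
  refine LinearMap.ext fun p => ?_
  change Polynomial.derivative (X * Polynomial.derivative p)
    - Polynomial.derivative (Polynomial.derivative (X * p)) = (-1 : ℤ) • Polynomial.derivative p
  simp [Polynomial.derivative_mul]

lemma x_pow_ne_aux (m : ℕ) : xOp K ^ m ≠ 0 := by
  have h : Function.Injective (xOp K) := fun p q e =>
    mul_left_cancel₀ (Polynomial.X_ne_zero (R := K)) e
  intro e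
  have h2 : Function.Injective (xOp K ^ m : Module.End K (Polynomial K)) := by
    rw [Module.End.coe_pow]; exact h.iterate m
  rw [e] at h2
  exact one_ne_zero (h2 (a₁ := (1 : Polynomial K)) (a₂ := 0) (by simp))

lemma d_pow_ne_aux (m : ℕ) : derOp K ^ m ≠ 0 := by
  intro e
  have h := LinearMap.congr_fun e ((X : Polynomial K) ^ m)
  rw [Module.End.coe_pow] at h
  change Polynomial.derivative^[m] (X ^ m) = 0 at h
  rw [Polynomial.iterate_derivative_X_pow_eq_smul] at h
  simp [Nat.descFactorial_self, Nat.factorial_ne_zero] at h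

/-- The set of eigenvalues of the inner derivation
`ad(H) : I₁ → I₁, a ↦ Ha - aH` is exactly `ℤ`. -/
theorem eigenvalues_of_ad_H :
    (∀ m : ℤ, ∃ a : I1 K, a ≠ 0 ∧ HelI K * a - a * HelI K = m • a) ∧
    (∀ (a : I1 K) (ν : K), a ≠ 0 → HelI K * a - a * HelI K = ν • a →
      ∃ m : ℤ, ν = (m : K)) := by
  constructor
  · intro m
    obtain ⟨n, rfl | rfl⟩ := m.eq_nat_or_neg
    · refine ⟨⟨xOp K ^ n, pow_mem (xOp_mem K) n⟩, ?_, ?_⟩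
      · intro h
        exact x_pow_ne_aux K n (congrArg Subtype.val h)
      · apply Subtype.ext
        have := ad_pow_aux _ _ _ (ad_x_aux K) n
        rw [mul_one] at this
        exact this
    · refine ⟨⟨derOp K ^ n, pow_mem (derOp_mem K) n⟩, ?_, ?_⟩
      · intro h
        exact d_pow_ne_aux K n (congrArg Subtype.val h)
      · apply Subtype.ext
        have := ad_pow_aux _ _ _ (ad_d_aux K) n
        rw [mul_neg_one] at this
        exact this
  · rintro ⟨a, ha⟩ ν hne e
    have e' : Hop K * a - a * Hop K = ν • a := congrArg Subtype.val e
    by_contra hν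
    push Not at hν
    apply hne
    apply Subtype.ext
    change a = 0
    refine Polynomial.lhom_ext' fun n => LinearMap.ext_ring ?_
    change a (Polynomial.monomial n 1) = 0
    ext k
    have h1 := congrArg (fun q => Polynomial.coeff q k)
      (LinearMap.congr_fun e' (Polynomial.monomial n 1))
    simp only [LinearMap.sub_apply, Module.End.mul_apply, LinearMap.smul_apply,
      Hop_monomial_aux, map_smul, Polynomial.coeff_sub, Polynomial.coeff_smul,
      coeff_Hop_aux, smul_eq_mul] at h1
    rw [Polynomial.coeff_zero]
    by_contra hc
    apply hν ((k : ℤ) - n)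
    apply mul_right_cancel₀ hc
    rw [← h1]
    push_cast
    ring


end
end

section
/- The family of operators { H^j∂^i : i ≥ 1, j ≥ 0 } ∪ { H^j : j ≥ 0 } ∪ { ∫^i H^j : i ≥ 1, j ≥ 0 } ∪ { e_{st} : s, t ≥ 0 } is a K-basis of I_1: these elements are linearly independent over K and span I_1 as a K-vector space. (Equivalently, every element of I_1 is a unique finite sum Σ_{i>0} a_{-i}∂^i + a_0 + Σ_{i>0} ∫^i a_i + Σ_{i,j} λ_{ij} e_{ij} with each a_k a polynomial in H and λ_{ij} ∈ K.) -/
set_option linter.unusedSectionVars false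

open Polynomial

noncomputable section

variable (K : Type*) [Field K] [CharZero K]

set_option synthInstance.maxHeartbeats 400000
set_option maxHeartbeats 1000000

/-- The family `{H^j ∂^{i+1}} ∪ {H^j} ∪ {∫^{i+1} H^j} ∪ {e_{st}}`
(so the exponents of `∂` and `∫` range over `i ≥ 1`). -/
def basisFam : ((ℕ × ℕ) ⊕ ℕ ⊕ (ℕ × ℕ) ⊕ (ℕ × ℕ)) → Module.End K (Polynomial K)
  | Sum.inl (i, j) => Hop K ^ j * derOp K ^ (i + 1)
  | Sum.inr (Sum.inl j) => Hop K ^ j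
  | Sum.inr (Sum.inr (Sum.inl (i, j))) => intOp K ^ (i + 1) * Hop K ^ j
  | Sum.inr (Sum.inr (Sum.inr (s, t))) => eOp K s t

def yv (n : ℕ) : Polynomial K := Polynomial.monomial n ((n.factorial : K)⁻¹)

lemma ext_y {A B : Module.End K (Polynomial K)} (h : ∀ n, A (yv K n) = B (yv K n)) : A = B := by
  apply Polynomial.lhom_ext'
  intro n
  apply LinearMap.ext_ring
  have e : (Polynomial.monomial n (1 : K)) = (n.factorial : K) • yv K n := by
    rw [yv, Polynomial.smul_monomial, smul_eq_mul, mul_inv_cancel₀ (fac_ne K n)]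
  simp only [LinearMap.comp_apply]
  rw [e, map_smul, map_smul, h]

lemma der_zero : derOp K (yv K 0) = 0 := by simp [derOp, yv]

lemma der_succ (n : ℕ) : derOp K (yv K (n+1)) = yv K n := by
  have h1 := fac_ne K n
  have h2 : (n : K) + 1 ≠ 0 := by exact_mod_cast n.succ_ne_zero
  simp only [derOp, yv, Polynomial.derivative_monomial, Nat.factorial_succ]
  push_cast
  congr 1
  field_simp

lemma int_y (n : ℕ) : intOp K (yv K n) = yv K (n+1) := by
  simp only [intOp, yv, Polynomial.lsum_apply, Nat.factorial_succ]
  rw [Polynomial.sum_monomial_index _ _ (by simp)]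
  simp only [LinearMap.smul_apply, Polynomial.smul_monomial]
  push_cast
  rw [mul_inv]; rfl

lemma x_y (n : ℕ) : xOp K (yv K n) = ((n : K) + 1) • yv K (n+1) := by
  have h1 := fac_ne K n
  have h2 : (n : K) + 1 ≠ 0 := by exact_mod_cast n.succ_ne_zero
  simp only [xOp, yv, LinearMap.mulLeft_apply, Polynomial.X_mul_monomial,
    Polynomial.smul_monomial, Nat.factorial_succ]
  push_cast
  congr 1
  simp only [smul_eq_mul]
  field_simp

lemma H_y (n : ℕ) : Hop K (yv K n) = ((n : K) + 1) • yv K n := by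
  rw [Hop, Module.End.mul_apply, x_y, map_smul, der_succ]

lemma der_int : derOp K * intOp K = 1 := ext_y K fun n => by
  simp [Module.End.mul_apply, int_y, der_succ]

lemma x_eq : xOp K = intOp K * Hop K := ext_y K fun n => by
  simp [Module.End.mul_apply, int_y, x_y, H_y]

lemma der_H : derOp K * Hop K = Hop K * derOp K + derOp K := ext_y K fun n => by
  cases n with
  | zero => simp [Module.End.mul_apply, H_y, der_zero]
  | succ n => simp [Module.End.mul_apply, H_y, der_succ, add_smul]

lemma H_int : Hop K * intOp K = intOp K * Hop K + intOp K := ext_y K fun n => by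
  simp [Module.End.mul_apply, H_y, int_y, add_smul]

lemma H_int_pow (i : ℕ) :
    Hop K * intOp K ^ i = intOp K ^ i * Hop K + (i : K) • intOp K ^ i := by
  induction i with
  | zero => simp
  | succ i ih =>
    rw [pow_succ, ← mul_assoc, ih, add_mul, mul_assoc, H_int]
    push_cast
    rw [mul_add, add_smul, one_smul, smul_mul_assoc, mul_assoc]
    abel

lemma int_pow_y (i n : ℕ) : (intOp K ^ i) (yv K n) = yv K (n + i) := by
  induction i with
  | zero => simp
  | succ i ih => rw [pow_succ', Module.End.mul_apply, ih, int_y, add_assoc]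

lemma der_pow_y (i n : ℕ) : (derOp K ^ i) (yv K n) = if i ≤ n then yv K (n - i) else 0 := by
  induction i with
  | zero => simp
  | succ i ih =>
    rw [pow_succ', Module.End.mul_apply, ih]
    split_ifs with h1 h2 h2
    · obtain ⟨k, hk⟩ : ∃ k, n - i = k + 1 := ⟨n - i - 1, by omega⟩
      rw [hk, der_succ]; congr 1; omega
    · have : n - i = 0 := by omega
      rw [this, der_zero]
    · omega
    · simp

lemma H_pow_y (j n : ℕ) : (Hop K ^ j) (yv K n) = (((n : K) + 1) ^ j) • yv K n := by
  induction j with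
  | zero => simp
  | succ j ih => rw [pow_succ', Module.End.mul_apply, ih, map_smul, H_y, smul_smul, pow_succ]

lemma e_y (s t n : ℕ) : eOp K s t (yv K n) = if n = t then yv K s else 0 := by
  simp only [eOp, LinearMap.sub_apply, Module.End.mul_apply, der_pow_y]
  rcases lt_trichotomy n t with h | h | h
  · rw [if_neg (by omega), if_neg (by omega), if_neg (by omega)]; simp
  · rw [if_pos (by omega), if_neg (by omega), if_pos h, int_pow_y]; simp [h]
  · rw [if_pos (by omega), if_pos (by omega), if_neg (by omega), int_pow_y, int_pow_y]
    rw [sub_eq_zero]; congr 1; omega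

lemma H_e (s t : ℕ) : Hop K * eOp K s t = ((s : K) + 1) • eOp K s t := ext_y K fun n => by
  simp only [Module.End.mul_apply, LinearMap.smul_apply, e_y]
  split_ifs <;> simp [H_y]

lemma int_e (s t : ℕ) : intOp K * eOp K s t = eOp K (s+1) t := ext_y K fun n => by
  simp only [Module.End.mul_apply, e_y]
  split_ifs <;> simp [int_y]

lemma der_e_succ (s t : ℕ) : derOp K * eOp K (s+1) t = eOp K s t := ext_y K fun n => by
  simp only [Module.End.mul_apply, e_y]
  split_ifs <;> simp [der_succ]

lemma der_e_zero (t : ℕ) : derOp K * eOp K 0 t = 0 := ext_y K fun n => by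
  simp only [Module.End.mul_apply, e_y]
  split_ifs <;> simp [der_zero]

def Sp : Submodule K (Module.End K (Polynomial K)) := Submodule.span K (Set.range (basisFam K))

lemma mem_HD (i j : ℕ) : Hop K ^ j * derOp K ^ i ∈ Sp K := by
  cases i with
  | zero => 
    have h : Hop K ^ j ∈ Sp K := Submodule.subset_span ⟨Sum.inr (Sum.inl j), rfl⟩
    simpa using h
  | succ i => exact Submodule.subset_span ⟨Sum.inl (i, j), rfl⟩

lemma mem_IH (i j : ℕ) : intOp K ^ i * Hop K ^ j ∈ Sp K := by
  cases i with
  | zero => 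
    have h : Hop K ^ j ∈ Sp K := Submodule.subset_span ⟨Sum.inr (Sum.inl j), rfl⟩
    simpa using h
  | succ i => exact Submodule.subset_span ⟨Sum.inr (Sum.inr (Sum.inl (i, j))), rfl⟩

lemma mem_e (s t : ℕ) : eOp K s t ∈ Sp K :=
  Submodule.subset_span ⟨Sum.inr (Sum.inr (Sum.inr (s, t))), rfl⟩

lemma closed_of (T : Module.End K (Polynomial K))
    (h1 : ∀ i j, T * (Hop K ^ j * derOp K ^ i) ∈ Sp K)
    (h2 : ∀ i j, T * (intOp K ^ i * Hop K ^ j) ∈ Sp K)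
    (h3 : ∀ s t, T * eOp K s t ∈ Sp K) :
    ∀ w ∈ Sp K, T * w ∈ Sp K := by
  have : Sp K ≤ (Sp K).comap (LinearMap.mulLeft K T) := by
    conv_lhs => rw [Sp]
    rw [Submodule.span_le]
    rintro _ ⟨a, rfl⟩
    rcases a with ⟨i, j⟩ | j | ⟨i, j⟩ | ⟨s, t⟩
    · exact h1 (i+1) j
    · have := h1 0 j
      rw [pow_zero, mul_one] at this
      exact this
    · exact h2 (i+1) j
    · exact h3 s t
  exact fun w hw => this hw

lemma closed_H : ∀ w ∈ Sp K, Hop K * w ∈ Sp K := by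
  apply closed_of
  · intro i j
    rw [← mul_assoc, ← pow_succ']; exact mem_HD K i (j+1)
  · intro i j
    rw [← mul_assoc, H_int_pow, add_mul, mul_assoc, ← pow_succ', smul_mul_assoc]
    exact add_mem (mem_IH K _ _) (Submodule.smul_mem _ _ (mem_IH K _ _))
  · intro s t
    rw [H_e]; exact Submodule.smul_mem _ _ (mem_e K _ _)

lemma closed_D : ∀ w ∈ Sp K, derOp K * w ∈ Sp K := by
  have hD : ∀ i j, derOp K * (Hop K ^ j * derOp K ^ i) ∈ Sp K := by
    intro i j
    induction j with
    | zero =>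
      rw [pow_zero, one_mul, ← pow_succ']
      simpa using mem_HD K (i+1) 0
    | succ j ih =>
      rw [pow_succ', mul_assoc, ← mul_assoc, der_H, add_mul, mul_assoc]
      exact add_mem (closed_H K _ ih) ih
  apply closed_of
  · exact hD
  · intro i j
    cases i with
    | zero =>
      have := hD 0 j
      simpa using this
    | succ i =>
      rw [pow_succ', ← mul_assoc, ← mul_assoc, der_int, one_mul]
      exact mem_IH K _ _
  · intro s t
    cases s with
    | zero => rw [der_e_zero]; exact zero_mem _
    | succ s => rw [der_e_succ]; exact mem_e K _ _

lemma closed_I : ∀ w ∈ Sp K, intOp K * w ∈ Sp K := by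
  have hI : ∀ i j, intOp K * (intOp K ^ i * Hop K ^ j) ∈ Sp K := by
    intro i j
    rw [← mul_assoc, ← pow_succ']; exact mem_IH K _ _
  apply closed_of
  · intro i j
    cases i with
    | zero =>
      have := hI 0 j
      simpa using this
    | succ i =>
      induction j with
      | zero =>
        have : intOp K * (Hop K ^ 0 * derOp K ^ (i+1)) = Hop K ^ 0 * derOp K ^ i - eOp K 0 i := by
          simp [eOp]
        rw [this]
        exact sub_mem (mem_HD K _ _) (mem_e K _ _)
      | succ j ih =>
        have h : intOp K * Hop K = Hop K * intOp K - intOp K := by rw [H_int]; abel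
        rw [pow_succ', mul_assoc, ← mul_assoc, h, sub_mul, mul_assoc]
        exact sub_mem (closed_H K _ ih) ih
  · exact hI
  · intro s t
    rw [int_e]; exact mem_e K _ _

lemma closed_all (T : Module.End K (Polynomial K)) (hT : T ∈ I1 K) :
    ∀ w ∈ Sp K, T * w ∈ Sp K := by
  unfold I1 at hT
  induction hT using Algebra.adjoin_induction with
  | mem x hx =>
    rcases hx with rfl | rfl | rfl
    · intro w hw
      rw [x_eq, mul_assoc]
      exact closed_I K _ (closed_H K _ hw)
    · exact closed_D K
    · exact closed_I K
  | algebraMap r =>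
    intro w hw
    rw [← Algebra.smul_def]; exact Submodule.smul_mem _ _ hw
  | add x y _ _ hx hy =>
    intro w hw; rw [add_mul]; exact add_mem (hx w hw) (hy w hw)
  | mul x y _ _ hx hy =>
    intro w hw; rw [mul_assoc]; exact hx _ (hy w hw)

lemma span_eq : Submodule.span K (Set.range (basisFam K)) = Subalgebra.toSubmodule (I1 K) := by
  apply le_antisymm
  · rw [Submodule.span_le]
    rintro _ ⟨a, rfl⟩
    rcases a with ⟨i, j⟩ | j | ⟨i, j⟩ | ⟨s, t⟩
    · exact (I1 K).mul_mem (pow_mem (Hop_mem K) _) (pow_mem (derOp_mem K) _)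
    · exact pow_mem (Hop_mem K) _
    · exact (I1 K).mul_mem (pow_mem (intOp_mem K) _) (pow_mem (Hop_mem K) _)
    · exact eOp_mem K s t
  · intro T hT
    have h1 : (1 : Module.End K (Polynomial K)) ∈ Sp K := by simpa using mem_HD K 0 0
    have := closed_all K T hT 1 h1
    rwa [mul_one] at this

/-- Matrix entries of the basis elements. -/
def Ent : ((ℕ × ℕ) ⊕ ℕ ⊕ (ℕ × ℕ) ⊕ (ℕ × ℕ)) → ℕ → ℕ → K
  | Sum.inl (i, j), m, n => if n = m + (i + 1) then ((m : K) + 1) ^ j else 0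
  | Sum.inr (Sum.inl j), m, n => if n = m then ((n : K) + 1) ^ j else 0
  | Sum.inr (Sum.inr (Sum.inl (i, j))), m, n => if n + (i + 1) = m then ((n : K) + 1) ^ j else 0
  | Sum.inr (Sum.inr (Sum.inr (s, t))), m, n => if n = t ∧ s = m then 1 else 0

lemma y_coeff (k m : ℕ) : (m.factorial : K) * (yv K k).coeff m = if k = m then 1 else 0 := by
  rw [yv, Polynomial.coeff_monomial]
  split_ifs with h
  · subst h; exact mul_inv_cancel₀ (fac_ne K _)
  · simp

lemma ent_eq (a) (m n : ℕ) :
    (m.factorial : K) * (basisFam K a (yv K n)).coeff m = Ent K a m n := by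
  rcases a with ⟨i, j⟩ | j | ⟨i, j⟩ | ⟨s, t⟩
  · simp only [basisFam, Ent, Module.End.mul_apply, der_pow_y]
    by_cases h : i + 1 ≤ n
    · rw [if_pos h, H_pow_y, Polynomial.coeff_smul, smul_eq_mul, mul_left_comm, y_coeff]
      by_cases h2 : n = m + (i+1)
      · have h3 : n - (i+1) = m := by omega
        rw [if_pos h2, h3]; simp
      · rw [if_neg h2, if_neg (by omega), mul_zero]
    · rw [if_neg h, if_neg (by omega)]; simp
  · simp only [basisFam, Ent]
    rw [H_pow_y, Polynomial.coeff_smul, smul_eq_mul, mul_left_comm, y_coeff]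
    simp
  · simp only [basisFam, Ent, Module.End.mul_apply]
    rw [H_pow_y, map_smul, int_pow_y, Polynomial.coeff_smul, smul_eq_mul, mul_left_comm, y_coeff]
    simp
  · simp only [basisFam, Ent, e_y]
    by_cases h : n = t
    · rw [if_pos h, y_coeff]; simp [h]
    · simp [h]

lemma poly_key {ι : Type*} (S : Finset ι) (f : ι → K) (E : ι → ℕ → K) (q : ι → Polynomial K)
    (h0 : ∀ m, ∑ a ∈ S, f a * E a m = 0)
    (h : ∀ a, ∀ᶠ m : ℕ in Filter.atTop, (q a).eval ((m : K) + 1) = E a m) :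
    ∑ a ∈ S, f a • q a = 0 := by
  have h1 : ∀ᶠ m : ℕ in Filter.atTop, ∀ a ∈ S, (q a).eval ((m : K) + 1) = E a m :=
    (Filter.eventually_all_finset S).2 fun a _ => h a
  obtain ⟨N, hN⟩ := Filter.eventually_atTop.1 h1
  apply Polynomial.eq_zero_of_infinite_isRoot
  apply Set.Infinite.mono (s := Set.range fun m : ℕ => (((m + N : ℕ) : K) + 1))
  · rintro _ ⟨m, rfl⟩
    simp only [Set.mem_ofPred_eq, Polynomial.IsRoot.def, Polynomial.eval_finsetSum,
      Polynomial.eval_smul, smul_eq_mul]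
    rw [← h0 (m + N)]
    exact Finset.sum_congr rfl fun a ha => by rw [hN (m + N) (by omega) a ha]
  · apply Set.infinite_range_of_injective
    intro a b hab
    have : ((a + N : ℕ) : K) = ((b + N : ℕ) : K) := by simpa using hab
    have := Nat.cast_injective this
    omega

lemma key2 {ι : Type*} (S : Finset ι) (f : ι → K) (E : ι → ℕ → K) (q : ι → Polynomial K)
    (h0 : ∀ m, ∑ a ∈ S, f a * E a m = 0)
    (h : ∀ a, ∀ᶠ m : ℕ in Filter.atTop, (q a).eval ((m : K) + 1) = E a m)
    (a : ι) (ha : a ∈ S) (j : ℕ) (hj : (q a).coeff j = 1)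
    (hb : ∀ b, b ≠ a → (q b).coeff j = 0) : f a = 0 := by
  have := congrArg (fun p => Polynomial.coeff p j) (poly_key K S f E q h0 h)
  simp only [Polynomial.finsetSum_coeff, Polynomial.coeff_smul, smul_eq_mul,
    Polynomial.coeff_zero] at this
  rw [Finset.sum_eq_single a (fun b _ hba => by rw [hb b hba, mul_zero])
    (fun h => absurd ha h), hj, mul_one] at this
  exact this

def q1 (i : ℕ) : ((ℕ × ℕ) ⊕ ℕ ⊕ (ℕ × ℕ) ⊕ (ℕ × ℕ)) → Polynomial K
  | Sum.inl (i', j) => if i' = i then Polynomial.X ^ j else 0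
  | _ => 0

def q2 : ((ℕ × ℕ) ⊕ ℕ ⊕ (ℕ × ℕ) ⊕ (ℕ × ℕ)) → Polynomial K
  | Sum.inr (Sum.inl j) => Polynomial.X ^ j
  | _ => 0

def q3 (i : ℕ) : ((ℕ × ℕ) ⊕ ℕ ⊕ (ℕ × ℕ) ⊕ (ℕ × ℕ)) → Polynomial K
  | Sum.inr (Sum.inr (Sum.inl (i', j))) => if i' = i then Polynomial.X ^ j else 0
  | _ => 0

lemma q1_ev (i : ℕ) (a) : ∀ᶠ m : ℕ in Filter.atTop,
    (q1 K i a).eval ((m : K) + 1) = Ent K a m (m + (i + 1)) := by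
  rcases a with ⟨i', j⟩ | j | ⟨i', j⟩ | ⟨s, t⟩
  · refine Filter.Eventually.of_forall fun m => ?_
    simp only [q1, Ent]
    by_cases h : i' = i
    · subst h; simp
    · rw [if_neg h, if_neg (by omega)]; simp
  · refine Filter.Eventually.of_forall fun m => ?_
    simp [q1, Ent]
  · refine Filter.Eventually.of_forall fun m => ?_
    simp only [q1, Ent]
    rw [if_neg (by omega)]; simp
  · filter_upwards [Filter.eventually_gt_atTop s] with m hm
    simp only [q1, Ent]
    rw [if_neg (by omega)]; simp

lemma q2_ev (a) : ∀ᶠ m : ℕ in Filter.atTop,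
    (q2 K a).eval ((m : K) + 1) = Ent K a m m := by
  rcases a with ⟨i', j⟩ | j | ⟨i', j⟩ | ⟨s, t⟩
  · refine Filter.Eventually.of_forall fun m => ?_
    simp [q2, Ent]
  · refine Filter.Eventually.of_forall fun m => ?_
    simp [q2, Ent]
  · refine Filter.Eventually.of_forall fun m => ?_
    simp [q2, Ent]
  · filter_upwards [Filter.eventually_gt_atTop s] with m hm
    simp only [q2, Ent]
    rw [if_neg (by omega)]; simp

lemma q3_ev (i : ℕ) (a) : ∀ᶠ m : ℕ in Filter.atTop,
    (q3 K i a).eval ((m : K) + 1) = Ent K a (m + (i + 1)) m := by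
  rcases a with ⟨i', j⟩ | j | ⟨i', j⟩ | ⟨s, t⟩
  · refine Filter.Eventually.of_forall fun m => ?_
    simp only [q3, Ent]
    rw [if_neg (by omega)]; simp
  · refine Filter.Eventually.of_forall fun m => ?_
    simp [q3, Ent]
  · refine Filter.Eventually.of_forall fun m => ?_
    simp only [q3, Ent]
    by_cases h : i' = i
    · subst h; simp
    · rw [if_neg h, if_neg (by omega)]; simp
  · filter_upwards [Filter.eventually_gt_atTop t] with m hm
    simp only [q3, Ent]
    rw [if_neg (by omega)]; simp

lemma lin_indep : LinearIndependent K (basisFam K) := by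
  rw [linearIndependent_iff']
  intro S f hf
  have h0 : ∀ m n, ∑ a ∈ S, f a * Ent K a m n = 0 := by
    intro m n
    have := congrArg (fun T : Module.End K (Polynomial K) =>
      (m.factorial : K) * (T (yv K n)).coeff m) hf
    simp only [LinearMap.sum_apply, LinearMap.smul_apply, Polynomial.finsetSum_coeff,
      Polynomial.coeff_smul, smul_eq_mul, LinearMap.zero_apply, Polynomial.coeff_zero, mul_zero,
      Finset.mul_sum] at this
    rw [← this]
    refine Finset.sum_congr rfl fun a _ => ?_
    rw [← ent_eq]; ring
  have A1 : ∀ i j, Sum.inl (i, j) ∈ S → f (Sum.inl (i, j)) = 0 := by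
    intro i j ha
    refine key2 K S f (fun a m => Ent K a m (m + (i+1))) (q1 K i) (fun m => h0 _ _) (q1_ev K i)
      _ ha j (by simp [q1]) ?_
    rintro (⟨i', j'⟩ | j' | ⟨i', j'⟩ | ⟨s, t⟩) hne
    · simp only [q1]
      split_ifs with h
      · subst h
        rw [Polynomial.coeff_X_pow, if_neg]
        rintro rfl; exact hne rfl
      · simp
    all_goals simp [q1]
  have A2 : ∀ j, Sum.inr (Sum.inl j) ∈ S → f (Sum.inr (Sum.inl j)) = 0 := by
    intro j ha
    refine key2 K S f (fun a m => Ent K a m m) (q2 K) (fun m => h0 _ _) (q2_ev K)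
      _ ha j (by simp [q2]) ?_
    rintro (⟨i', j'⟩ | j' | ⟨i', j'⟩ | ⟨s, t⟩) hne
    · simp [q2]
    · simp only [q2]
      rw [Polynomial.coeff_X_pow, if_neg]
      rintro rfl; exact hne rfl
    all_goals simp [q2]
  have A3 : ∀ i j, Sum.inr (Sum.inr (Sum.inl (i, j))) ∈ S →
      f (Sum.inr (Sum.inr (Sum.inl (i, j)))) = 0 := by
    intro i j ha
    refine key2 K S f (fun a m => Ent K a (m + (i+1)) m) (q3 K i) (fun m => h0 _ _) (q3_ev K i)
      _ ha j (by simp [q3]) ?_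
    rintro (⟨i', j'⟩ | j' | ⟨i', j'⟩ | ⟨s, t⟩) hne
    · simp [q3]
    · simp [q3]
    · simp only [q3]
      split_ifs with h
      · subst h
        rw [Polynomial.coeff_X_pow, if_neg]
        rintro rfl; exact hne rfl
      · simp
    · simp [q3]
  rintro (⟨i, j⟩ | j | ⟨i, j⟩ | ⟨s, t⟩) ha
  · exact A1 i j ha
  · exact A2 j ha
  · exact A3 i j ha
  · have := h0 s t
    rw [Finset.sum_eq_single _ ?_ (fun h => absurd ha h)] at this
    · simpa [Ent] using this
    · rintro (⟨i', j'⟩ | j' | ⟨i', j'⟩ | ⟨s', t'⟩) hb hne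
      · rw [A1 _ _ hb, zero_mul]
      · rw [A2 _ hb, zero_mul]
      · rw [A3 _ _ hb, zero_mul]
      · simp only [Ent]
        rw [if_neg, mul_zero]
        rintro ⟨rfl, rfl⟩; exact hne rfl

/-- The family `{H^j∂^i : i ≥ 1, j ≥ 0} ∪ {H^j : j ≥ 0} ∪
`{∫^i H^j : i ≥ 1, j ≥ 0} ∪ {e_{st} : s,t ≥ 0}` is a `K`-basis of `I₁`: it is linearly
independent over `K` and spans `I₁` as a `K`-vector space. -/
theorem basis_of_I1 :
    LinearIndependent K (basisFam K) ∧
    Submodule.span K (Set.range (basisFam K)) = Subalgebra.toSubmodule (I1 K) :=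
  ⟨lin_indep K, span_eq K⟩

end
end
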